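/- Fix a prime g ≥ 3. For every ε > 0 there exists a constant C = C(g, ε) such that for all real X ≥ 2 and all real H with 1 ≤ H ≤ X^{1/2 - 1/(2g) + ε}, the number of squarefree integers d ∈ [X, 2X) with h_g(-d) > H is at most C · X^ε · ( X H^{-1} + X^{g/2} H^{-(g+1)} ). -/

import Mathlib

/-- The imaginary quadratic field `ℚ(√-d)`, realized as the subfield of `ℂ`
generated over `ℚ` by `√d · i`. -/
noncomputable def Kneg (d : ℕ) : IntermediateField ℚ ℂ :=
  IntermediateField.adjoin ℚ {(Real.sqrt d : ℂ) * Complex.I}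

/-- `hneg g d` is the `g`-part of the class number of `ℚ(√-d)`: the number of
ideal classes `c` of the ring of integers of `ℚ(√-d)` with `c ^ g = 1`. -/
noncomputable def hneg (g d : ℕ) : ℕ :=
  Nat.card {c : ClassGroup (NumberField.RingOfIntegers (Kneg d)) // c ^ g = 1}

section

open Finset

theorem exists_card_divisors_le_rpow {δ : ℝ} (hδ : 0 < δ) :
    ∃ C : ℝ, 1 ≤ C ∧ ∀ n : ℕ, n ≠ 0 → (n.divisors.card : ℝ) ≤ C * (n : ℝ) ^ δ := by
  have hl : 0 < δ * Real.log 2 := mul_pos hδ (Real.log_pos one_lt_two)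
  set c : ℝ := 1 + (δ * Real.log 2)⁻¹ with hc
  have hc1 : 1 ≤ c := by rw [hc]; linarith [inv_pos.mpr hl]
  obtain ⟨N, hN⟩ := exists_nat_ge ((2 : ℝ) ^ δ⁻¹)
  have small : ∀ p a : ℕ, 2 ≤ p → ((a : ℝ) + 1) ≤ c * ((p : ℝ) ^ a) ^ δ := by
    intro p a hp
    have h2 : ((2 : ℝ) ^ a) ^ δ ≤ ((p : ℝ) ^ a) ^ δ := by
      gcongr
      exact_mod_cast hp
    have h3 : 1 + a * (δ * Real.log 2) ≤ ((2 : ℝ) ^ a) ^ δ := by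
      rw [Real.rpow_def_of_pos (by positivity), Real.log_pow]
      have := Real.add_one_le_exp (a * Real.log 2 * δ)
      nlinarith
    have h4 : (a : ℝ) + 1 ≤ c * (1 + a * (δ * Real.log 2)) := by
      have : (δ * Real.log 2)⁻¹ * (a * (δ * Real.log 2)) = a := by field_simp
      rw [hc]
      nlinarith [inv_pos.mpr hl, mul_nonneg (Nat.cast_nonneg (α := ℝ) a) hl.le]
    exact h4.trans (mul_le_mul_of_nonneg_left (h3.trans h2) (by linarith))
  have large : ∀ p a : ℕ, N ≤ p → ((a : ℝ) + 1) ≤ ((p : ℝ) ^ a) ^ δ := by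
    intro p a hp
    have h1 : (2 : ℝ) ≤ (p : ℝ) ^ δ := by
      have : ((2 : ℝ) ^ δ⁻¹) ^ δ ≤ (p : ℝ) ^ δ := by
        gcongr
        exact hN.trans (by exact_mod_cast hp)
      rwa [← Real.rpow_mul (by norm_num), inv_mul_cancel₀ hδ.ne', Real.rpow_one] at this
    have h2 : ((p : ℝ) ^ a) ^ δ = ((p : ℝ) ^ δ) ^ a := by
      rw [← Real.rpow_natCast, ← Real.rpow_natCast, ← Real.rpow_mul (by positivity),
        ← Real.rpow_mul (by positivity), mul_comm]
    rw [h2]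
    have h3 : ((a : ℝ) + 1) ≤ 2 ^ a := by exact_mod_cast Nat.lt_two_pow_self
    exact h3.trans (pow_le_pow_left₀ (by norm_num) h1 a)
  refine ⟨c ^ N, one_le_pow₀ hc1, fun n hn => ?_⟩
  have hprod : (n : ℝ) ^ δ = ∏ p ∈ n.primeFactors, ((p : ℝ) ^ n.factorization p) ^ δ := by
    rw [Real.finsetProd_rpow _ _ (fun _ _ => by positivity)]
    congr 1
    conv_lhs => rw [← Nat.prod_factorization_pow_eq_self hn]
    simp [Finsupp.prod]
  have hbd : ∀ p ∈ n.primeFactors, ((n.factorization p : ℝ) + 1) ≤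
      (if p < N then c else 1) * ((p : ℝ) ^ n.factorization p) ^ δ := by
    intro p hp
    split_ifs with h
    · exact small p _ (Nat.prime_of_mem_primeFactors hp).two_le
    · rw [one_mul]; exact large p _ (not_lt.mp h)
  rw [Nat.card_divisors hn, hprod]
  push_cast
  refine (prod_le_prod (fun _ _ => by positivity) hbd).trans ?_
  rw [prod_mul_distrib]
  gcongr
  rw [← prod_filter, prod_const]
  refine pow_le_pow_right₀ hc1 ?_
  calc _ ≤ (range N).card := card_le_card (fun p hp => by simpa using (mem_filter.mp hp).2)
    _ = N := card_range N

/-- The odd primes up to `y`. -/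
def oddPrimesLE (y : ℕ) : Finset ℕ := (range (y + 1)).filter fun p => p.Prime ∧ p ≠ 2

theorem exists_le_card_oddPrimesLE {δ : ℝ} (hδ : 0 < δ) :
    ∃ c : ℝ, 0 < c ∧ ∃ N : ℕ, ∀ y : ℕ, N ≤ y → c * (y : ℝ) ^ (1 - δ) ≤ (oddPrimesLE y).card := by
  have hlog := (isLittleO_log_rpow_atTop hδ).def (c := 1) one_pos
  have hlog1 := (isLittleO_log_rpow_atTop (one_pos)).def (c := 1 / 16) (by norm_num)
  have hbig : ∀ᶠ y : ℝ in Filter.atTop, 16 ≤ y ∧ 16 ≤ y ^ (1 - δ) ∨ 16 ≤ y ∧ 1 ≤ δ := by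
    rcases lt_or_ge δ 1 with h | h
    · filter_upwards [Filter.eventually_ge_atTop 16,
        (tendsto_rpow_atTop (sub_pos.mpr h)).eventually_ge_atTop 16] with y h1 h2
      exact Or.inl ⟨h1, h2⟩
    · filter_upwards [Filter.eventually_ge_atTop 16] with y h1 using Or.inr ⟨h1, h⟩
  obtain ⟨N, hN⟩ := Filter.eventually_atTop.mp
    (tendsto_natCast_atTop_atTop.eventually (hlog.and (hlog1.and hbig)))
  refine ⟨1 / 16, by norm_num, N, fun y hy => ?_⟩
  obtain ⟨h1, h2, h3⟩ := hN y hy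
  have hy16 : (16 : ℝ) ≤ y := by rcases h3 with h | h <;> exact h.1
  have hlpos : 0 < Real.log y := Real.log_pos (by linarith)
  rw [Real.norm_of_nonneg hlpos.le, Real.norm_of_nonneg (by positivity)] at h1 h2
  rw [Real.rpow_one] at h2
  have hpsi := (Chebyshev.psi_ge y).trans (Chebyshev.psi_le_primeCounting_mul_log y)
  have hl2 := Real.log_two_gt_d9
  have hly : Real.log ((y : ℝ) + 1) ≤ 2 * Real.log y := by
    rw [← Real.log_rpow (by linarith)] 
    apply Real.log_le_log (by linarith)
    norm_cast
    nlinarith [(by exact_mod_cast hy16 : 16 ≤ y)]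
  have hcard : (Nat.primeCounting y : ℝ) ≤ (oddPrimesLE y).card + 1 := by
    rw [Nat.primeCounting, Nat.primeCounting', Nat.count_eq_card_filter_range]
    have : (filter Nat.Prime (range (y + 1))) ⊆ insert 2 (oddPrimesLE y) := by
      intro p hp
      simp only [oddPrimesLE, mem_insert, mem_filter] at *
      tauto
    exact_mod_cast (card_le_card this).trans (card_insert_le _ _)
  have hmain : (y : ℝ) / 2 ≤ ((oddPrimesLE y).card + 1) * Real.log y := by
    nlinarith
  have hyd : (y : ℝ) ^ (1 - δ) * (y : ℝ) ^ δ = y := by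
    rw [← Real.rpow_add (by linarith)]; simp
  have hmain2 : (y : ℝ) ^ (1 - δ) / 2 ≤ (oddPrimesLE y).card + 1 := by
    have hp : 0 < (y : ℝ) ^ δ := by positivity
    have : (y : ℝ) ^ (1 - δ) / 2 * (y : ℝ) ^ δ ≤ ((oddPrimesLE y).card + 1) * (y : ℝ) ^ δ := by
      calc _ = (y : ℝ) / 2 := by rw [div_mul_eq_mul_div, hyd]
        _ ≤ _ := hmain
        _ ≤ _ := by gcongr; linarith
    exact le_of_mul_le_mul_right this hp
  rcases h3 with h | h
  · linarith [h.2]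
  · have : (y : ℝ) ^ (1 - δ) ≤ 1 := Real.rpow_le_one_of_one_le_of_nonpos (by linarith) (by linarith)
    have h3 : 3 ∈ oddPrimesLE y := by
      have : 16 ≤ y := by exact_mod_cast hy16
      simp only [oddPrimesLE, mem_filter, mem_range]
      exact ⟨by omega, Nat.prime_three, by norm_num⟩
    have : (1 : ℝ) ≤ (oddPrimesLE y).card := by exact_mod_cast card_pos.mpr ⟨3, h3⟩
    linarith

end

section

open Finset

/-- The operator `f ↦ (s ↦ ∑_{n < L} f (n + s))`. -/
def shiftSum (L : ℕ) (f : ℕ → ℤ) (s : ℕ) : ℤ := ∑ n ∈ range L, f (n + s)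

theorem shiftSum_periodic {q : ℕ} (L : ℕ) {f : ℕ → ℤ} (hf : Function.Periodic f q) :
    Function.Periodic (shiftSum L f) q := fun s => by
  simp only [shiftSum, ← add_assoc, hf _]

theorem sum_range_add_of_periodic {q : ℕ} {f : ℕ → ℤ} (hf : Function.Periodic f q) (s : ℕ) :
    ∑ n ∈ range q, f (n + s) = ∑ n ∈ range q, f n := by
  induction s with
  | zero => simp
  | succ s ih =>
    rw [← ih]
    have h1 := sum_range_succ (fun n => f (n + s)) q
    have h2 := sum_range_succ' (fun n => f (n + s)) q
    have h3 : f (q + s) = f (0 + s) := by rw [add_comm q, zero_add, hf]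
    have h4 : ∀ n, n + 1 + s = n + (s + 1) := fun n => by ring
    simp only [h4] at h2
    linarith

theorem sum_range_shiftSum {q : ℕ} (L : ℕ) {f : ℕ → ℤ} (hf : Function.Periodic f q)
    (h0 : ∑ n ∈ range q, f n = 0) : ∑ n ∈ range q, shiftSum L f n = 0 := by
  simp only [shiftSum]
  rw [sum_comm]
  refine sum_eq_zero fun m _ => ?_
  simp only [add_comm m, sum_range_add_of_periodic hf, h0]

theorem abs_shiftSum_le_mul {L : ℕ} {f : ℕ → ℤ} {M : ℤ} (hM : ∀ n, |f n| ≤ M) (s : ℕ) :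
    |shiftSum L f s| ≤ L * M :=
  (abs_sum_le_sum_abs _ _).trans ((sum_le_card_nsmul _ _ M fun _ _ => hM _).trans (by simp))

theorem abs_shiftSum_le_of_periodic {q : ℕ} (hq : 0 < q) (L : ℕ) {f : ℕ → ℤ}
    (hf : Function.Periodic f q) (h0 : ∑ n ∈ range q, f n = 0) {M : ℤ} (hM : ∀ n, |f n| ≤ M)
    (s : ℕ) : |shiftSum L f s| ≤ q * M := by
  have hM0 : 0 ≤ M := (abs_nonneg _).trans (hM 0)
  induction L using Nat.strong_induction_on with
  | _ L ih =>
    rcases lt_or_ge L q with h | h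
    · refine (abs_shiftSum_le_mul hM s).trans ?_
      gcongr
    · obtain ⟨r, rfl⟩ := Nat.exists_eq_add_of_le h
      have : shiftSum (q + r) f s = shiftSum r f s := by
        simp only [shiftSum]
        rw [sum_range_add, sum_range_add_of_periodic hf, h0, zero_add]
        refine sum_congr rfl fun n _ => ?_
        rw [show q + n + s = n + s + q by ring, hf]
      rw [this]
      exact ih r (by omega)

theorem abs_iterate_shiftSum_le {L : ℕ} {f : ℕ → ℤ} (hM : ∀ n, |f n| ≤ 1) (A s : ℕ) :
    |(shiftSum L)^[A] f s| ≤ (L : ℤ) ^ A := by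
  induction A generalizing s with
  | zero => simpa using hM s
  | succ A ih =>
    rw [Function.iterate_succ_apply', pow_succ']
    exact abs_shiftSum_le_mul ih s

theorem abs_iterate_shiftSum_le_of_periodic {q : ℕ} (hq : 0 < q) (L : ℕ) {f : ℕ → ℤ}
    (hf : Function.Periodic f q) (h0 : ∑ n ∈ range q, f n = 0) (hM : ∀ n, |f n| ≤ 1)
    (A s : ℕ) : |(shiftSum L)^[A] f s| ≤ (q : ℤ) ^ A := by
  suffices h : Function.Periodic ((shiftSum L)^[A] f) q ∧
      ∑ n ∈ range q, (shiftSum L)^[A] f n = 0 ∧ ∀ s, |(shiftSum L)^[A] f s| ≤ (q : ℤ) ^ A from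
    h.2.2 s
  induction A with
  | zero => exact ⟨hf, h0, by simpa using hM⟩
  | succ A ih =>
    obtain ⟨h1, h2, h3⟩ := ih
    simp only [Function.iterate_succ_apply', pow_succ']
    exact ⟨shiftSum_periodic L h1, sum_range_shiftSum L h1 h2,
      abs_shiftSum_le_of_periodic hq L h1 h2 h3⟩

theorem iterate_shiftSum_sum {ι : Type*} (T : Finset ι) (L : ℕ) (f : ι → ℕ → ℤ) (A s : ℕ) :
    (shiftSum L)^[A] (fun n => ∑ i ∈ T, f i n) s = ∑ i ∈ T, (shiftSum L)^[A] (f i) s := by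
  induction A generalizing s with
  | zero => rfl
  | succ A ih =>
    simp only [Function.iterate_succ_apply']
    conv_lhs => rw [shiftSum]
    simp only [ih]
    rw [sum_comm]
    rfl

theorem pow_mul_sum_le_iterate_shiftSum {L M : ℕ} (hML : M ≤ L) {f : ℕ → ℤ} (hf : ∀ n, 0 ≤ f n)
    (A s : ℕ) : (M : ℤ) ^ A * ∑ d ∈ Ico (s + A * M) (s + L), f d ≤ (shiftSum L)^[A + 1] f s := by
  induction A generalizing s with
  | zero =>
    simp only [pow_zero, one_mul, zero_mul, add_zero, zero_add, Function.iterate_one, shiftSum]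
    rw [sum_Ico_eq_sum_range]
    simp [add_comm]
  | succ A ih =>
    rw [Function.iterate_succ_apply', shiftSum]
    calc (M : ℤ) ^ (A + 1) * ∑ d ∈ Ico (s + (A + 1) * M) (s + L), f d
        = ∑ n ∈ range M, (M : ℤ) ^ A * ∑ d ∈ Ico (s + (A + 1) * M) (s + L), f d := by
          rw [sum_const, card_range, nsmul_eq_mul]; ring
      _ ≤ ∑ n ∈ range M, (shiftSum L)^[A + 1] f (n + s) := by
          refine sum_le_sum fun n hn => le_trans ?_ (ih (n + s))
          have hn := mem_range.mp hn
          refine mul_le_mul_of_nonneg_left (sum_le_sum_of_subset_of_nonneg ?_ fun _ _ _ => hf _)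
            (by positivity)
          refine Ico_subset_Ico ?_ (by omega)
          have : (A + 1) * M = A * M + M := by ring
          omega
      _ ≤ _ := by
          refine sum_le_sum_of_subset_of_nonneg (range_subset_range.mpr hML) fun n _ _ => ?_
          exact le_trans (mul_nonneg (by positivity) (sum_nonneg fun _ _ => hf _)) (ih (n + s))

open NumberTheorySymbols

theorem jacobiSym_neg_periodic (q : ℕ) : Function.Periodic (fun n : ℕ => J(-(n : ℤ) | q)) q :=
  fun n => jacobiSym.mod_left' (by
    push_cast
    rw [neg_add, ← sub_eq_add_neg, Int.sub_emod_right])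

theorem abs_jacobiSym_le_one (a : ℤ) (q : ℕ) : |J(a | q)| ≤ 1 := by
  rcases jacobiSym.trichotomy a q with h | h | h <;> simp [h]

theorem sum_jacobiSym_neg_eq_zero {q : ℕ} (hq : 0 < q) {a : ℕ} (ha : J((a : ℤ) | q) = -1) :
    ∑ n ∈ range q, J(-(n : ℤ) | q) = 0 := by
  have hcop : a.Coprime q := by
    by_contra h
    have : NeZero q := ⟨hq.ne'⟩
    have := (jacobiSym.eq_zero_iff_not_coprime (a := (a : ℤ)) (b := q)).mpr h
    omega
  have hbij : ∑ n ∈ range q, J(-((a * n % q : ℕ) : ℤ) | q) = ∑ n ∈ range q, J(-(n : ℤ) | q) := by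
    have hinj : Set.InjOn (fun n => a * n % q) (range q : Set ℕ) := by
      intro m hm n hn h
      have h1 : m ≡ n [MOD q] := Nat.ModEq.cancel_left_of_coprime hcop.symm h
      rw [coe_range] at hm hn
      exact h1.eq_of_lt_of_lt hm hn
    have himg : (range q).image (fun n => a * n % q) = range q :=
      eq_of_subset_of_card_le (image_subset_iff.mpr fun n _ => mem_range.mpr (Nat.mod_lt _ hq))
        (by rw [card_image_of_injOn hinj])
    conv_rhs => rw [← himg, sum_image hinj]
  have hneg : ∀ n : ℕ, J(-((a * n % q : ℕ) : ℤ) | q) = -J(-(n : ℤ) | q) := by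
    intro n
    have : J(-((a * n % q : ℕ) : ℤ) | q) = J((a : ℤ) * -(n : ℤ) | q) := by
      refine jacobiSym.mod_left' ?_
      push_cast
      have h := (Int.mod_modEq ((a : ℤ) * n) q).neg
      rw [mul_neg]
      exact h
    rw [this, jacobiSym.mul_left, ha]; ring
  simp only [hneg, sum_neg_distrib] at hbij
  omega

theorem jacobiSym_prod_right {ι : Type*} (s : Finset ι) (f : ι → ℕ) (hf : ∀ i ∈ s, f i ≠ 0)
    (a : ℤ) : J(a | ∏ i ∈ s, f i) = ∏ i ∈ s, J(a | f i) := by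
  induction s using Finset.cons_induction with
  | empty => simp
  | cons i s hi ih =>
    rw [prod_cons, prod_cons, jacobiSym.mul_right' a (hf i (mem_cons_self _ _))
      (prod_ne_zero_iff.mpr fun j hj => hf j (mem_cons_of_mem hj)),
      ih fun j hj => hf j (mem_cons_of_mem hj)]

theorem exists_jacobiSym_prod_eq_neg_one {ι : Type*} [Fintype ι] {f : ι → ℕ}
    (hf : ∀ i, (f i).Prime) {p : ℕ} (hp2 : p ≠ 2) (hp : p.Prime)
    (hodd : Odd (univ.filter fun i => f i = p).card) :
    ∃ a : ℕ, J((a : ℤ) | ∏ i, f i) = -1 := by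
  have := Fact.mk hp
  obtain ⟨u, hu⟩ := FiniteField.exists_nonsquare (F := ZMod p) (by rwa [ZMod.ringChar_zmod_n])
  set m := ∏ i ∈ univ.filter (fun i => f i ≠ p), f i with hm
  have hcop : p.Coprime m := Nat.Coprime.prod_right fun i hi =>
    (Nat.coprime_primes hp (hf i)).mpr (Ne.symm (mem_filter.mp hi).2)
  obtain ⟨a, ha1, ha2⟩ := Nat.chineseRemainder hcop u.val 1
  refine ⟨a, ?_⟩
  have hJp : J((a : ℤ) | p) = -1 := by
    refine ZMod.nonsquare_iff_jacobiSym_eq_neg_one.mpr ?_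
    have : ((a : ℤ) : ZMod p) = u := by
      have h := (ZMod.natCast_eq_natCast_iff _ _ _).mpr ha1
      rw [Int.cast_natCast, h, ZMod.natCast_zmod_val]
    rwa [this]
  have hJm : J((a : ℤ) | m) = 1 := by
    rw [← jacobiSym.one_left m]
    exact jacobiSym.mod_left' (by exact_mod_cast ha2)
  rw [← prod_filter_mul_prod_filter_not univ (fun i => f i = p), ← hm, jacobiSym.mul_right', hJm,
    mul_one, prod_congr rfl (fun i hi => (mem_filter.mp hi).2), prod_const, jacobiSym.pow_right,
    hJp, hodd.neg_one_pow]
  · exact prod_ne_zero_iff.mpr fun i _ => (hf i).ne_zero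
  · exact prod_ne_zero_iff.mpr fun i _ => (hf i).ne_zero

open Classical in
theorem card_even_fibers_le (P : Finset ℕ) (k : ℕ) :
    ((Fintype.piFinset fun _ : Fin (2 * k) => P).filter
      fun f => ∀ p, Even (univ.filter fun i => f i = p).card).card ≤ k ^ (2 * k) * P.card ^ k := by
  set T := (Fintype.piFinset fun _ : Fin k => P) ×ˢ (univ : Finset (Fin (2 * k) → Fin k))
  have hT : T.card = k ^ (2 * k) * P.card ^ k := by
    simp [T, card_product, Fintype.card_piFinset, mul_comm]
  rw [← hT]
  refine (card_le_card (t := T.image fun eg => eg.1 ∘ eg.2) ?_).trans card_image_le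
  intro f hf
  obtain ⟨hfP, hev⟩ := mem_filter.mp hf
  rw [Fintype.mem_piFinset] at hfP
  set I := univ.image f
  have hcard : I.card ≤ k := by
    have h1 : ∑ p ∈ I, (univ.filter fun i => f i = p).card = 2 * k := by
      rw [← card_eq_sum_card_image, card_univ, Fintype.card_fin]
    have h2 : ∑ p ∈ I, 2 ≤ ∑ p ∈ I, (univ.filter fun i => f i = p).card := by
      refine sum_le_sum fun p hp => ?_
      obtain ⟨i, _, hi⟩ := mem_image.mp hp
      have : 0 < (univ.filter fun i => f i = p).card := card_pos.mpr ⟨i, by simp [hi]⟩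
      obtain ⟨r, hr⟩ := hev p
      omega
    rw [sum_const, smul_eq_mul] at h2
    omega
  rcases k.eq_zero_or_pos with rfl | hk
  · refine mem_image.mpr ⟨(Fin.elim0, Fin.elim0), ?_, funext fun i => Fin.elim0 i⟩
    simp only [T, mem_product, Fintype.mem_piFinset, mem_univ, and_true]
    exact fun i => Fin.elim0 i
  obtain ⟨ι⟩ : Nonempty (I ↪ Fin k) :=
    Function.Embedding.nonempty_of_card_le (by simpa using hcard)
  have hI : ∀ i, f i ∈ I := fun i => mem_image_of_mem f (mem_univ i)
  set p0 := f ⟨0, by omega⟩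
  refine mem_image.mpr ⟨(fun j => if h : ∃ p : I, ι p = j then (h.choose : ℕ) else p0,
    fun i => ι ⟨f i, hI i⟩), ?_, ?_⟩
  · simp only [T, mem_product, Fintype.mem_piFinset, mem_univ, and_true]
    intro j
    split_ifs with h
    · obtain ⟨i, _, hi⟩ := mem_image.mp h.choose.2
      rw [← hi]; exact hfP i
    · exact hfP _
  · funext i
    have h : ∃ p : I, ι p = ι ⟨f i, hI i⟩ := ⟨_, rfl⟩
    simp only [Function.comp_apply, dif_pos h, ι.injective h.choose_spec]

theorem mem_oddPrimesLE {y p : ℕ} : p ∈ oddPrimesLE y ↔ p ≤ y ∧ p.Prime ∧ p ≠ 2 := by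
  simp [oddPrimesLE]

/-- A large-sieve type bound for the number of `d` at which the sum of the symbols `(-d / p)` over
the odd primes `p ≤ y` is large. -/
theorem card_mul_pow_le_of_abs_sum_jacobiSym_ge {y k A L M t : ℕ} (hML : M ≤ L) {B : Finset ℕ}
    (hB : B ⊆ Ico (A * M) L)
    (ht : ∀ d ∈ B, (t : ℤ) ≤ |∑ p ∈ oddPrimesLE y, J(-(d : ℤ) | p)|) :
    M ^ A * (B.card * t ^ (2 * k)) ≤
      k ^ (2 * k) * (oddPrimesLE y).card ^ k * L ^ (A + 1) +
        (oddPrimesLE y).card ^ (2 * k) * (y ^ (2 * k)) ^ (A + 1) := by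
  classical
  set P := oddPrimesLE y
  set F : ℕ → ℤ := fun d => (∑ p ∈ P, J(-(d : ℤ) | p)) ^ (2 * k)
  have hF0 : ∀ d, 0 ≤ F d := fun d => (even_two_mul k).pow_nonneg _
  have h1 : ((M ^ A * (B.card * t ^ (2 * k)) : ℕ) : ℤ) ≤ (shiftSum L)^[A + 1] F 0 := by
    refine le_trans ?_ (pow_mul_sum_le_iterate_shiftSum hML hF0 A 0)
    push_cast
    refine mul_le_mul_of_nonneg_left ?_ (by positivity)
    calc (B.card : ℤ) * (t : ℤ) ^ (2 * k) = ∑ d ∈ B, (t : ℤ) ^ (2 * k) := by simp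
      _ ≤ ∑ d ∈ B, F d := sum_le_sum fun d hd => by
          simp only [F]
          rw [← (even_two_mul k).pow_abs (∑ p ∈ P, J(-(d : ℤ) | p))]
          exact pow_le_pow_left₀ (by positivity) (ht d hd) _
      _ ≤ _ := sum_le_sum_of_subset_of_nonneg (by simpa using hB) fun _ _ _ => hF0 _
  set T := Fintype.piFinset fun _ : Fin (2 * k) => P
  have hF : F = fun d : ℕ => ∑ f ∈ T, J(-(d : ℤ) | ∏ i, f i) := by
    funext d
    have : F d = ∏ _i : Fin (2 * k), ∑ p ∈ P, J(-(d : ℤ) | p) := by simp [F]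
    rw [this, prod_univ_sum]
    refine sum_congr rfl fun f hf => ?_
    rw [jacobiSym_prod_right]
    exact fun i _ => (mem_oddPrimesLE.mp (Fintype.mem_piFinset.mp hf i)).2.1.ne_zero
  have hTcard : T.card = P.card ^ (2 * k) := by simp [T]
  have h2 : (shiftSum L)^[A + 1] F 0 ≤
      ((k ^ (2 * k) * P.card ^ k * L ^ (A + 1) +
        P.card ^ (2 * k) * (y ^ (2 * k)) ^ (A + 1) : ℕ) : ℤ) := by
    rw [hF, iterate_shiftSum_sum,
      ← sum_filter_add_sum_filter_not T (fun f => ∀ p, Even (univ.filter fun i => f i = p).card)]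
    push_cast
    gcongr
    · refine (sum_le_card_nsmul _ _ ((L : ℤ) ^ (A + 1)) fun f _ => (le_abs_self _).trans
        (abs_iterate_shiftSum_le (fun n => abs_jacobiSym_le_one _ _) _ _)).trans ?_
      rw [nsmul_eq_mul]
      gcongr
      exact_mod_cast card_even_fibers_le P k
    · refine (sum_le_card_nsmul _ _ (((y : ℤ) ^ (2 * k)) ^ (A + 1)) fun f hf => ?_).trans ?_
      · obtain ⟨hfT, hodd⟩ := mem_filter.mp hf
        push Not at hodd
        obtain ⟨p, hp⟩ := hodd
        rw [Nat.not_even_iff_odd] at hp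
        have hfP := fun i => mem_oddPrimesLE.mp (Fintype.mem_piFinset.mp hfT i)
        obtain ⟨i, hi⟩ := card_pos.mp hp.pos
        have hi : f i = p := (mem_filter.mp hi).2
        obtain ⟨a, ha⟩ := exists_jacobiSym_prod_eq_neg_one (fun i => (hfP i).2.1)
          (hi ▸ (hfP i).2.2) (hi ▸ (hfP i).2.1) hp
        have hq : 0 < ∏ i, f i := prod_pos fun i _ => (hfP i).2.1.pos
        refine (le_abs_self _).trans ((abs_iterate_shiftSum_le_of_periodic hq L
          (jacobiSym_neg_periodic _) (sum_jacobiSym_neg_eq_zero hq ha)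
          (fun n => abs_jacobiSym_le_one _ _) _ _).trans ?_)
        gcongr
        have : ∏ i, f i ≤ ∏ _i : Fin (2 * k), y := prod_le_prod' fun i _ => (hfP i).1
        simpa using (by exact_mod_cast this : ((∏ i, f i : ℕ) : ℤ) ≤ ((∏ _i : Fin (2 * k), y : ℕ) : ℤ))
      · rw [nsmul_eq_mul]
        gcongr
        rw [← Nat.cast_pow, ← hTcard]
        exact_mod_cast card_filter_le _ _
  exact_mod_cast h1.trans h2

end

section

open Finset

theorem card_le_of_modEq_of_le_add {S : Finset ℕ} {m r l : ℕ}
    (hmod : ∀ u ∈ S, ∀ u' ∈ S, u ≡ u' [MOD m]) (hr : ∀ u ∈ S, r ≤ u ∧ u ≤ r + l) :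
    S.card ≤ l / m + 1 := by
  rw [← card_range (l / m + 1)]
  refine card_le_card_of_injOn (fun u => (u - r) / m) (fun u hu => ?_) fun u hu u' hu' h => ?_
  · have := hr u hu
    simp only [coe_range, Set.mem_Iio, Nat.lt_succ_iff]
    exact Nat.div_le_div_right (by omega)
  · have h1 := hr u hu
    have h2 := hr u' hu'
    have h3 : (u - r) % m = (u' - r) % m := by
      refine Nat.ModEq.add_right_cancel' r ?_
      rw [Nat.sub_add_cancel h1.1, Nat.sub_add_cancel h2.1]
      exact hmod u hu u' hu'
    have h4 : u - r = u' - r := by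
      rw [← Nat.div_add_mod (u - r) m, ← Nat.div_add_mod (u' - r) m, h3]
      simp only at h
      rw [h]
    omega

theorem card_sq_roots_le {v k g N : ℕ} (hv : 0 < v) (hvk : v.Coprime k) {S : Finset ℕ}
    (hS : ∀ u ∈ S, (v : ℤ) ^ 2 ∣ (u : ℤ) ^ 2 - 4 * (k : ℤ) ^ g)
    (hN : ∀ u ∈ S, ∀ u' ∈ S, u' ≤ u + N * v) :
    (S.card : ℝ) ≤ ((v ^ 2).divisors.card : ℝ) ^ 2 * (16 * N / v + 1) := by
  rcases S.eq_empty_or_nonempty with rfl | hne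
  · simp only [card_empty, Nat.cast_zero]; positivity
  obtain ⟨r, hrS, hrmin⟩ := S.exists_min_image id hne
  simp only [id] at hrmin
  have hv2 : 0 < v ^ 2 := by positivity
  set D := (v ^ 2).divisors
  have hmaps : ∀ u ∈ S, ((u - r).gcd (v ^ 2), (u + r).gcd (v ^ 2)) ∈ D ×ˢ D := fun u _ => by
    simp [D, Nat.gcd_dvd_right, hv.ne']
  have hfib : ∀ e ∈ D ×ˢ D, (S.filter fun u =>
      ((u - r).gcd (v ^ 2), (u + r).gcd (v ^ 2)) = e).card ≤ 16 * N / v + 1 := by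
    rintro ⟨e₁, e₂⟩ he
    rw [mem_product, Nat.mem_divisors, Nat.mem_divisors] at he
    rcases (S.filter fun u =>
      ((u - r).gcd (v ^ 2), (u + r).gcd (v ^ 2)) = (e₁, e₂)).eq_empty_or_nonempty with h | h
    · rw [h, card_empty]; exact Nat.zero_le _
    obtain ⟨w, hw⟩ := h
    simp only [mem_filter, Prod.mk.injEq] at hw
    obtain ⟨hwS, hw1, hw2⟩ := hw
    have hrw := hrmin w hwS
    have hd : v ^ 2 ∣ (w - r) * (w + r) := by
      zify [hrw]
      rw [show ((w : ℤ) - r) * (w + r) =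
        (w ^ 2 - 4 * (k : ℤ) ^ g) - (r ^ 2 - 4 * (k : ℤ) ^ g) by ring]
      exact dvd_sub (hS w hwS) (hS r hrS)
    have hd2 : v ^ 2 ∣ e₁ * e₂ := by
      rw [← hw1, ← hw2, Nat.gcd_comm, Nat.gcd_comm (w + r)]
      exact Nat.dvd_gcd_mul_iff_dvd_mul.mpr (Nat.dvd_mul_gcd_iff_dvd_mul.mpr hd)
    have hgcd : e₁.gcd e₂ ∣ 16 := by
      set e := e₁.gcd e₂
      have h1 : e ∣ v ^ 2 := (Nat.gcd_dvd_left _ _).trans he.1.1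
      have h2 : e ∣ 2 * r := by
        have ha : e ∣ w - r := (Nat.gcd_dvd_left _ _).trans (hw1 ▸ Nat.gcd_dvd_left _ _)
        have hb : e ∣ w + r := (Nat.gcd_dvd_right _ _).trans (hw2 ▸ Nat.gcd_dvd_left _ _)
        have := Nat.dvd_sub hb ha
        rwa [show w + r - (w - r) = 2 * r by omega] at this
      have h3 : (e : ℤ) ∣ 16 * (k : ℤ) ^ g := by
        have ha : (e : ℤ) ∣ (2 * r : ℤ) * (2 * r) := Dvd.dvd.mul_right (by exact_mod_cast h2) _
        have hb : (e : ℤ) ∣ 4 * ((r : ℤ) ^ 2 - 4 * (k : ℤ) ^ g) :=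
          Dvd.dvd.mul_left (Dvd.dvd.trans (by exact_mod_cast h1) (hS r hrS)) _
        rw [show 16 * (k : ℤ) ^ g =
          (2 * r : ℤ) * (2 * r) - 4 * ((r : ℤ) ^ 2 - 4 * (k : ℤ) ^ g) by ring]
        exact dvd_sub ha hb
      have h4 : e ∣ 16 * k ^ g := by exact_mod_cast h3
      refine (Nat.Coprime.dvd_of_dvd_mul_right ?_ h4)
      exact Nat.Coprime.of_dvd_left h1 ((hvk.pow_left 2).pow_right g)
    have hlcm : v ^ 2 ≤ 16 * e₁.lcm e₂ := by
      have h0 : 0 < e₁ * e₂ := Nat.mul_pos (Nat.pos_of_dvd_of_pos he.1.1 hv2)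
        (Nat.pos_of_dvd_of_pos he.2.1 hv2)
      calc v ^ 2 ≤ e₁ * e₂ := Nat.le_of_dvd h0 hd2
        _ = e₁.gcd e₂ * e₁.lcm e₂ := (Nat.gcd_mul_lcm _ _).symm
        _ ≤ _ := Nat.mul_le_mul_right _ (Nat.le_of_dvd (by norm_num) hgcd)
    have hm : 0 < e₁.lcm e₂ := by nlinarith
    refine (card_le_of_modEq_of_le_add (m := e₁.lcm e₂) (r := r) (l := N * v) ?_ ?_).trans ?_
    · have key : ∀ u ∈ S, (u - r).gcd (v ^ 2) = e₁ → (u + r).gcd (v ^ 2) = e₂ →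
          (e₁ : ℤ) ∣ u - r ∧ (e₂ : ℤ) ∣ u + r := by
        rintro u hu h1 h2
        constructor
        · rw [← Nat.cast_sub (hrmin u hu)]
          exact_mod_cast h1 ▸ Nat.gcd_dvd_left _ _
        · exact_mod_cast h2 ▸ Nat.gcd_dvd_left _ _
      intro u hu u' hu'
      simp only [mem_filter, Prod.mk.injEq] at hu hu'
      obtain ⟨a1, a2⟩ := key u hu.1 hu.2.1 hu.2.2
      obtain ⟨b1, b2⟩ := key u' hu'.1 hu'.2.1 hu'.2.2
      have c1 : (e₁ : ℤ) ∣ u' - u := by have := dvd_sub b1 a1; rwa [sub_sub_sub_cancel_right] at this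
      have c2 : (e₂ : ℤ) ∣ u' - u := by have := dvd_sub b2 a2; rwa [add_sub_add_right_eq_sub] at this
      exact Nat.modEq_of_dvd (by
        rw [← Int.natAbs_dvd_natAbs, Int.natAbs_natCast] at *
        exact Nat.lcm_dvd c1 c2)
    · intro u hu
      have hu := (mem_filter.mp hu).1
      exact ⟨hrmin u hu, hN r hrS u hu⟩
    · refine Nat.add_le_add_right ?_ 1
      rw [Nat.le_div_iff_mul_le hv]
      have h1 := Nat.div_mul_le_self (N * v) (e₁.lcm e₂)
      by_contra hcon
      push Not at hcon
      have : 16 * N * v < N * v / e₁.lcm e₂ * v ^ 2 := by nlinarith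
      have h2 : N * v / e₁.lcm e₂ * v ^ 2 ≤ N * v / e₁.lcm e₂ * (16 * e₁.lcm e₂) :=
        Nat.mul_le_mul_left _ hlcm
      nlinarith
  have hcard := card_le_mul_card_image_of_maps_to hmaps _ hfib
  rw [card_product] at hcard
  have h1 : (S.card : ℝ) ≤ ((16 * N / v + 1 : ℕ) : ℝ) * (D.card * D.card) := by exact_mod_cast hcard
  have h2 : ((16 * N / v + 1 : ℕ) : ℝ) ≤ 16 * N / v + 1 := by
    push_cast
    gcongr
    exact (Nat.cast_div_le).trans (by push_cast; rfl)
  calc (S.card : ℝ) ≤ _ := h1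
    _ ≤ (16 * N / v + 1) * (D.card * D.card) := by gcongr
    _ = _ := by ring

theorem card_le_sum_of_four_mul_pow_eq {k g N V : ℕ} {D : Finset ℕ}
    (hD : ∀ d ∈ D, ∀ d' ∈ D, d' ≤ d + N ^ 2)
    (h : ∀ d ∈ D, ∃ u v : ℕ, 0 < v ∧ v ≤ V ∧ v.Coprime k ∧ 4 * k ^ g = u ^ 2 + d * v ^ 2) :
    (D.card : ℝ) ≤ ∑ v ∈ Icc 1 V, ((v ^ 2).divisors.card : ℝ) ^ 2 * (16 * N / v + 1) := by
  choose! u v hv0 hvV hcop heq using h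
  rw [card_eq_sum_card_fiberwise (f := v) (t := Icc 1 V)
    fun d hd => by simpa using ⟨hv0 d hd, hvV d hd⟩]
  push_cast
  refine sum_le_sum fun w hw => ?_
  have hw0 : 0 < w := (mem_Icc.mp hw).1
  rcases (D.filter fun d => v d = w).eq_empty_or_nonempty with he | ⟨d₀, hd₀⟩
  · rw [he, card_empty, Nat.cast_zero]; positivity
  have hwk : w.Coprime k := by
    obtain ⟨h1, rfl⟩ := mem_filter.mp hd₀
    exact hcop d₀ h1
  have hinj : Set.InjOn u (D.filter fun d => v d = w : Finset ℕ) := by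
    intro d hd d' hd' huu
    obtain ⟨h1, h2⟩ := mem_filter.mp (mem_coe.mp hd)
    obtain ⟨h1', h2'⟩ := mem_filter.mp (mem_coe.mp hd')
    have e1 := heq d h1
    have e2 := heq d' h1'
    rw [h2] at e1
    rw [h2', ← huu] at e2
    have : d * w ^ 2 = d' * w ^ 2 := by omega
    exact Nat.eq_of_mul_eq_mul_right (by positivity) this
  rw [← card_image_of_injOn hinj]
  refine card_sq_roots_le (k := k) (g := g) hw0 hwk ?_ ?_
  · simp only [mem_image, mem_filter]
    rintro _ ⟨d, ⟨h1, rfl⟩, rfl⟩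
    refine ⟨-d, ?_⟩
    have := heq d h1
    zify at this
    rw [this]; ring
  · simp only [mem_image, mem_filter]
    rintro _ ⟨d, ⟨h1, h2⟩, rfl⟩ _ ⟨d', ⟨h1', h2'⟩, rfl⟩
    have e1 := heq d h1
    have e2 := heq d' h1'
    rw [h2] at e1
    rw [h2'] at e2
    have := hD d' h1' d h1
    by_contra hcon
    push Not at hcon
    have h3 : (u d + N * w) ^ 2 < u d' ^ 2 := Nat.pow_lt_pow_left hcon (by norm_num)
    have h4 : d * w ^ 2 ≤ (d' + N ^ 2) * w ^ 2 := Nat.mul_le_mul_right _ this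
    nlinarith [Nat.zero_le (u d * (N * w))]

end

section

open Finset

/-- `O` behaves like the ring of integers of `ℚ(√-d)`, with `α` in the role of `√-d`. -/
structure IsImagQuadOrder {O : Type*} [CommRing O] (d : ℕ) (α : O) : Prop where
  sq_eq : α ^ 2 = -(d : O)
  indep : ∀ a b : ℤ, (a : O) + b * α = 0 → a = 0 ∧ b = 0
  exists_two_mul_eq : ∀ x : O, ∃ u v : ℤ, 2 * x = u + v * α
  exists_conj : ∃ σ : O →+* O, σ α = -α

namespace IsImagQuadOrder

variable {O : Type*} [CommRing O] {d : ℕ} {α : O}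

theorem ext (h : IsImagQuadOrder d α) {a b a' b' : ℤ} (he : (a : O) + b * α = a' + b' * α) :
    a = a' ∧ b = b' := by
  have := h.indep (a - a') (b - b') (by push_cast; linear_combination he)
  omega

theorem intCast_inj (h : IsImagQuadOrder d α) {a b : ℤ} (he : (a : O) = b) : a = b :=
  (h.ext (a := a) (b := 0) (a' := b) (b' := 0) (by simpa using he)).1

theorem two_mul_ne_one (h : IsImagQuadOrder d α) (x : O) : 2 * x ≠ 1 := by
  intro hx
  obtain ⟨u, v, huv⟩ := h.exists_two_mul_eq (x ^ 2)
  have := (h.ext (a := 1) (b := 0) (a' := 2 * u) (b' := 2 * v)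
    (by push_cast; linear_combination 2 * huv - (2 * x + 1) * hx)).1
  omega

theorem intCast_of_two_mul_eq (h : IsImagQuadOrder d α) {x : O} {n : ℤ} (hx : 2 * x = n) :
    Even n := by
  by_contra hn
  obtain ⟨m, rfl⟩ := Int.not_even_iff_odd.mp hn
  exact h.two_mul_ne_one (x - m) (by push_cast at hx; linear_combination hx)

theorem intCast_dvd_intCast (h : IsImagQuadOrder d α) {a b : ℤ} (hab : (a : O) ∣ b) : a ∣ b := by
  obtain ⟨x, hx⟩ := hab
  obtain ⟨u, v, huv⟩ := h.exists_two_mul_eq x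
  rcases eq_or_ne a 0 with rfl | ha
  · rw [Int.cast_zero, zero_mul] at hx
    rw [h.intCast_inj (a := b) (b := 0) (by simpa using hx)]
  have h1 := h.ext (a := 2 * b) (b := 0) (a' := a * u) (b' := a * v)
    (by push_cast; linear_combination 2 * hx + a * huv)
  have hv : v = 0 := (mul_eq_zero.mp h1.2.symm).resolve_left ha
  obtain ⟨m, rfl⟩ := h.intCast_of_two_mul_eq (x := x) (n := u) (by rw [huv, hv]; simp)
  exact ⟨m, by linarith [h1.1]⟩

/-- The ideal `(p, α - t)`. -/
def idl (α : O) (p : ℕ) (t : ℤ) : Ideal O := Ideal.span {(p : O), α - t}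

theorem natCast_mem_idl (p : ℕ) (t : ℤ) : (p : O) ∈ idl α p t :=
  Ideal.subset_span (by simp)

theorem idl_mul_idl_neg (h : IsImagQuadOrder d α) {p : ℕ} {t : ℤ}
    (ht : (p : ℤ) ∣ t ^ 2 + d) (hp : IsCoprime (p : ℤ) (2 * t)) :
    idl α p t * idl α p (-t) = Ideal.span {(p : O)} := by
  rw [idl, idl, Ideal.span_pair_mul_span_pair]
  obtain ⟨c, hc⟩ := ht
  have hc' : (t : O) ^ 2 + d = p * c := by exact_mod_cast congrArg (Int.cast (R := O)) hc
  apply le_antisymm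
  · rw [Ideal.span_le]
    rintro x (rfl | rfl | rfl | rfl)
    · exact Ideal.mem_span_singleton.mpr ⟨p, rfl⟩
    · exact Ideal.mem_span_singleton.mpr ⟨_, rfl⟩
    · exact Ideal.mem_span_singleton.mpr ⟨_, mul_comm _ _⟩
    · refine Ideal.mem_span_singleton.mpr ⟨-c, ?_⟩
      push_cast
      linear_combination h.sq_eq - hc'
  · rw [Ideal.span_singleton_le_iff_mem]
    obtain ⟨a, b, hab⟩ := hp
    have hab' : (a : O) * p + b * (2 * t) = 1 := by exact_mod_cast congrArg (Int.cast (R := O)) hab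
    set I := Ideal.span {(p : O) * p, p * (α - ((-t : ℤ) : O)), (α - t) * p,
      (α - t) * (α - ((-t : ℤ) : O))}
    have m1 : (p : O) * p ∈ I := Ideal.subset_span (by simp)
    have m2 : (p : O) * (α - ((-t : ℤ) : O)) ∈ I := Ideal.subset_span (by simp)
    have m3 : (α - t) * p ∈ I := Ideal.subset_span (by simp)
    have : (p : O) = a * (p * p) + b * (p * (α - ((-t : ℤ) : O)) - (α - t) * p) := by
      push_cast
      linear_combination -(p : O) * hab'
    rw [this]
    exact I.add_mem (I.mul_mem_left _ m1) (I.mul_mem_left _ (I.sub_mem m2 m3))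

theorem map_idl {σ : O →+* O} (hσ : σ α = -α) (p : ℕ) (t : ℤ) :
    (idl α p t).map σ = idl α p (-t) := by
  rw [idl, Ideal.map_span, Set.image_pair, map_natCast, map_sub, hσ, map_intCast, idl]
  have : -α - (t : O) = -(α - ((-t : ℤ) : O)) := by push_cast; ring
  rw [this, Ideal.span_pair_neg]

theorem isCoprime_idl_neg {p : ℕ} {t : ℤ} (hp : IsCoprime (p : ℤ) (2 * t)) :
    IsCoprime (idl α p t) (idl α p (-t)) := by
  obtain ⟨a, b, hab⟩ := hp
  have hab' : (a : O) * p + b * (2 * t) = 1 := by exact_mod_cast congrArg (Int.cast (R := O)) hab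
  refine Ideal.isCoprime_iff_exists.mpr ⟨a * p + b * -(α - t), ?_, b * (α - ((-t : ℤ) : O)), ?_, ?_⟩
  · exact Ideal.add_mem _ (Ideal.mul_mem_left _ _ (natCast_mem_idl p t))
      (Ideal.mul_mem_left _ _ (neg_mem (Ideal.subset_span (by simp))))
  · exact Ideal.mul_mem_left _ _ (Ideal.subset_span (by simp))
  · push_cast
    linear_combination hab'

theorem isCoprime_idl_of_coprime {p q : ℕ} (hpq : p.Coprime q) (t s : ℤ) :
    IsCoprime (idl α p t) (idl α q s) := by
  obtain ⟨a, b, hab⟩ := Nat.isCoprime_iff_coprime.mpr hpq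
  have hab' : (a : O) * p + b * q = 1 := by exact_mod_cast congrArg (Int.cast (R := O)) hab
  exact Ideal.isCoprime_iff_exists.mpr ⟨a * p, Ideal.mul_mem_left _ _ (natCast_mem_idl p t), b * q,
    Ideal.mul_mem_left _ _ (natCast_mem_idl q s), hab'⟩

theorem idl_ne_top (h : IsImagQuadOrder d α) {p : ℕ} {t : ℤ} (hp1 : p ≠ 1)
    (ht : (p : ℤ) ∣ t ^ 2 + d) (hp : IsCoprime (p : ℤ) (2 * t)) : idl α p t ≠ ⊤ := by
  intro htop
  obtain ⟨σ, hσ⟩ := h.exists_conj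
  have h2 := map_idl hσ p t
  rw [htop, Ideal.map_top] at h2
  have h3 := h.idl_mul_idl_neg ht hp
  rw [htop, ← h2, Ideal.top_mul, eq_comm, Ideal.span_singleton_eq_top] at h3
  have h4 : (p : ℤ) ∣ 1 := h.intCast_dvd_intCast (by simpa using h3.dvd (a := (1 : O)))
  exact hp1 (by exact_mod_cast Int.eq_one_of_dvd_one (by positivity) h4)

theorem not_natCast_dvd {I J : Ideal O} {β : O} (hβ : I = Ideal.span {β})
    (hIJ : IsCoprime J I) (hJ : J ≠ ⊤) {p : ℕ} (hp : (p : O) ∈ J) : ¬ (p : O) ∣ β := by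
  intro hdvd
  have h1 : I ≤ J := by
    rw [hβ, Ideal.span_singleton_le_iff_mem]
    exact J.mem_of_dvd hdvd hp
  exact hJ (by simpa [Ideal.isCoprime_iff_sup_eq, sup_eq_left.mpr h1] using hIJ)

theorem natCast_dvd_of_two_mul_eq {p : ℕ} (hp : p.Prime) (hp2 : p ≠ 2)
    {β : O} {u v : ℤ} (hβ : 2 * β = u + v * α) (hv : (p : ℤ) ∣ v)
    (hdvd : (p : ℤ) ∣ u ^ 2 + d * v ^ 2) : (p : O) ∣ β := by
  have hu : (p : ℤ) ∣ u := by
    refine (Nat.prime_iff_prime_int.mp hp).dvd_of_dvd_pow (n := 2) ?_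
    have : (p : ℤ) ∣ d * v ^ 2 := Dvd.dvd.mul_left (dvd_pow hv two_ne_zero) _
    exact (dvd_add_left this).mp hdvd
  obtain ⟨m, hm⟩ := hp.odd_of_ne_two hp2
  obtain ⟨u', rfl⟩ := hu
  obtain ⟨v', rfl⟩ := hv
  have hm' : (p : O) = 2 * m + 1 := by rw [hm]; push_cast; ring
  refine ⟨β - m * (u' + v' * α), ?_⟩
  push_cast at hβ
  linear_combination (-β) * hm' - m * hβ

/-- Two prime ideals of distinct norms `p`, `q` with equal `g`-th powers in the class group
give a representation of `4 (p q) ^ g` by the norm form. -/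
theorem exists_four_mul_pow_eq [IsDedekindDomain O] (h : IsImagQuadOrder d α) {p q g : ℕ}
    (hp : p.Prime) (hq : q.Prime) (hp2 : p ≠ 2) (hq2 : q ≠ 2) (hpq : p ≠ q) (hg : g ≠ 0)
    {t s : ℤ} (ht : (p : ℤ) ∣ t ^ 2 + d) (hs : (q : ℤ) ∣ s ^ 2 + d)
    (hpt : IsCoprime (p : ℤ) (2 * t)) (hqs : IsCoprime (q : ℤ) (2 * s))
    (hP : idl α p t ∈ nonZeroDivisors (Ideal O)) (hQ : idl α q s ∈ nonZeroDivisors (Ideal O))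
    (hcl : ClassGroup.mk0 ⟨idl α p t, hP⟩ ^ g = ClassGroup.mk0 ⟨idl α q s, hQ⟩ ^ g) :
    ∃ u v : ℕ, v.Coprime (p * q) ∧ 4 * (p * q) ^ g = u ^ 2 + d * v ^ 2 := by
  have hcast : ∀ n : ℕ, n ≠ 0 → (n : O) ≠ 0 := fun n hn h0 =>
    hn (by exact_mod_cast h.intCast_inj (a := n) (b := 0) (by simpa using h0))
  have hpt' : IsCoprime (p : ℤ) (2 * -t) := by rw [mul_neg]; exact hpt.neg_right
  have hqs' : IsCoprime (q : ℤ) (2 * -s) := by rw [mul_neg]; exact hqs.neg_right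
  have hcop : p.Coprime q := (Nat.coprime_primes hp hq).mpr hpq
  have hQ' : idl α q (-s) ∈ nonZeroDivisors (Ideal O) := by
    refine mem_nonZeroDivisors_of_ne_zero fun h0 => hcast q hq.ne_zero ?_
    have := natCast_mem_idl (α := α) q (-s)
    rwa [h0] at this
  have hQQ : ClassGroup.mk0 ⟨idl α q s, hQ⟩ * ClassGroup.mk0 ⟨idl α q (-s), hQ'⟩ = 1 := by
    rw [← map_mul, ClassGroup.mk0_eq_one_iff]
    exact ⟨⟨q, h.idl_mul_idl_neg hs hqs⟩⟩
  have hprin : ClassGroup.mk0 ((⟨idl α p t, hP⟩ : nonZeroDivisors (Ideal O)) ^ g *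
      (⟨idl α q (-s), hQ'⟩ : nonZeroDivisors (Ideal O)) ^ g) = 1 := by
    rw [map_mul, map_pow, map_pow, hcl, ← mul_pow, hQQ, one_pow]
  rw [ClassGroup.mk0_eq_one_iff] at hprin
  obtain ⟨β, hβ⟩ := hprin
  replace hβ : idl α p t ^ g * idl α q (-s) ^ g = Ideal.span {β} := hβ
  obtain ⟨σ, hσ⟩ := h.exists_conj
  have hσβ : idl α p (-t) ^ g * idl α q s ^ g = Ideal.span {σ β} := by
    have := congrArg (Ideal.map σ) hβ
    rwa [Ideal.map_mul, Ideal.map_pow, Ideal.map_pow, map_idl hσ, map_idl hσ, neg_neg,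
      Ideal.map_span, Set.image_singleton] at this
  have hprod : Ideal.span {β * σ β} = Ideal.span {((p : O) * q) ^ g} := by
    rw [← Ideal.span_singleton_mul_span_singleton, ← hβ, ← hσβ, ← Ideal.span_singleton_pow,
      ← Ideal.span_singleton_mul_span_singleton, ← h.idl_mul_idl_neg ht hpt,
      ← h.idl_mul_idl_neg hs hqs]
    simp only [mul_pow]
    ring
  obtain ⟨u, v, huv⟩ := h.exists_two_mul_eq β
  have hnorm : 4 * (β * σ β) = ((u ^ 2 + d * v ^ 2 : ℤ) : O) := by
    have h1 := congrArg σ huv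
    simp only [map_mul, map_add, map_ofNat, map_intCast, hσ] at h1
    push_cast
    linear_combination 2 * σ β * huv + (u + v * α) * h1 - (v : O) ^ 2 * h.sq_eq
  have heq : (4 * (p * q) ^ g : ℤ) = u ^ 2 + d * v ^ 2 := by
    apply Int.dvd_antisymm (by positivity) (by positivity)
    · apply h.intCast_dvd_intCast
      rw [← hnorm]
      push_cast
      exact mul_dvd_mul_left 4 (Ideal.span_singleton_le_span_singleton.mp hprod.le)
    · apply h.intCast_dvd_intCast
      rw [← hnorm]
      push_cast
      exact mul_dvd_mul_left 4 (Ideal.span_singleton_le_span_singleton.mp hprod.ge)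
  have hdvd : ∀ r : ℕ, r ∣ p * q → (r : ℤ) ∣ u ^ 2 + d * v ^ 2 := fun r hr => by
    rw [← heq]
    exact Dvd.dvd.mul_left (dvd_pow (by exact_mod_cast hr) hg) _
  refine ⟨u.natAbs, v.natAbs, Nat.Coprime.mul_right ?_ ?_, ?_⟩
  · rw [Nat.coprime_comm, hp.coprime_iff_not_dvd, ← Int.natCast_dvd]
    intro hv
    refine not_natCast_dvd hβ ?_ (h.idl_ne_top hp.ne_one (t := -t) (by simpa using ht) hpt')
      (natCast_mem_idl p (-t))
      (natCast_dvd_of_two_mul_eq hp hp2 huv hv (hdvd p (dvd_mul_right _ _)))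
    exact IsCoprime.mul_right (isCoprime_idl_neg hpt).symm.pow_right
      (isCoprime_idl_of_coprime hcop _ _).pow_right
  · rw [Nat.coprime_comm, hq.coprime_iff_not_dvd, ← Int.natCast_dvd]
    intro hv
    refine not_natCast_dvd hβ ?_ (h.idl_ne_top hq.ne_one hs hqs) (natCast_mem_idl q s)
      (natCast_dvd_of_two_mul_eq hq hq2 huv hv (hdvd q (dvd_mul_left _ _)))
    exact IsCoprime.mul_right (isCoprime_idl_of_coprime hcop.symm _ _).pow_right
      (isCoprime_idl_neg hqs).pow_right
  · zify
    simpa using heq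

end IsImagQuadOrder

end

section

open Finset

namespace IsImagQuadOrder

variable {O : Type*} [CommRing O] {d : ℕ} {α : O}

theorem two_mul_cancel [IsDomain O] (h : IsImagQuadOrder d α) {x y : O} (hxy : 2 * x = 2 * y) :
    x = y := by
  refine mul_left_cancel₀ (fun h0 => ?_) hxy
  have := h.intCast_inj (a := 2) (b := 0) (by simpa using h0)
  omega

/-- The coefficients of `α` in the doubles of the elements of an ideal. -/
def coeffIdeal (α : O) (I : Ideal O) : Ideal ℤ where
  carrier := {v | ∃ x ∈ I, ∃ u : ℤ, 2 * x = u + v * α}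
  add_mem' := by
    rintro v w ⟨x, hx, u, hu⟩ ⟨y, hy, u', hu'⟩
    exact ⟨x + y, I.add_mem hx hy, u + u', by push_cast; linear_combination hu + hu'⟩
  zero_mem' := ⟨0, I.zero_mem, 0, by simp⟩
  smul_mem' := by
    rintro c v ⟨x, hx, u, hu⟩
    exact ⟨c * x, I.mul_mem_left _ hx, c * u, by
      rw [smul_eq_mul]; push_cast; linear_combination (c : O) * hu⟩

theorem mem_coeffIdeal {I : Ideal O} {v : ℤ} :
    v ∈ coeffIdeal α I ↔ ∃ x ∈ I, ∃ u : ℤ, 2 * x = u + v * α := Iff.rfl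

/-- Nonzero ideals are described by triples of small integers. -/
theorem exists_normal_form [IsDomain O] (h : IsImagQuadOrder d α) (I : Ideal O) {n : ℕ}
    (hn : 0 < n) (hnI : (n : O) ∈ I) :
    ∃ a u m : ℕ, a ≤ n ∧ 1 ≤ u ∧ u ≤ 2 * a ∧ m ∣ u ∧ a ∣ u ^ 2 + d * m ^ 2 ∧
      ∀ x, x ∈ I ↔ ∃ s t : ℤ, 2 * x = 2 * a * s + t * (u + m * α) := by
  obtain ⟨a₀, ha₀⟩ := (IsPrincipalIdealRing.principal
    (Ideal.comap (Int.castRingHom O) I)).principal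
  obtain ⟨m₀, hm₀⟩ := (IsPrincipalIdealRing.principal (coeffIdeal α I)).principal
  have ha : ∀ j : ℤ, (j : O) ∈ I ↔ (a₀.natAbs : ℤ) ∣ j := fun j => by
    rw [Int.natAbs_dvd, ← Ideal.mem_span_singleton]
    change _ ↔ j ∈ Submodule.span ℤ {a₀}
    rw [← ha₀]
    rfl
  have hm : ∀ j : ℤ, j ∈ coeffIdeal α I ↔ (m₀.natAbs : ℤ) ∣ j := fun j => by
    rw [Int.natAbs_dvd, ← Ideal.mem_span_singleton, hm₀]
  generalize a₀.natAbs = a at ha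
  generalize m₀.natAbs = m at hm
  have han : a ∣ n := by exact_mod_cast (ha n).mp (by simpa using hnI)
  have hapos : 0 < a := Nat.pos_of_dvd_of_pos han hn
  obtain ⟨γ₀, hγ₀, u₀, hu₀⟩ := mem_coeffIdeal.mp ((hm m).mpr dvd_rfl)
  set u : ℕ := ((u₀ - 1) % (2 * a) + 1).toNat with hu
  have hmod1 := Int.emod_nonneg (u₀ - 1) (b := 2 * a) (by omega)
  have hmod2 := Int.emod_lt_of_pos (u₀ - 1) (b := 2 * a) (by omega)
  have hmod3 := Int.mul_ediv_add_emod (u₀ - 1) (2 * a)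
  have huz : (u : ℤ) = u₀ - 2 * a * ((u₀ - 1) / (2 * a)) := by omega
  set γ : O := γ₀ - a * (((u₀ - 1) / (2 * a) : ℤ) : O) with hγ
  have haI : (a : O) ∈ I := by simpa using (ha a).mpr dvd_rfl
  have hγI : γ ∈ I := I.sub_mem hγ₀ (I.mul_mem_right _ haI)
  have huO : (u : O) = u₀ - 2 * a * (((u₀ - 1) / (2 * a) : ℤ) : O) := by
    exact_mod_cast congrArg (Int.cast (R := O)) huz
  have hγ2 : 2 * γ = u + m * α := by
    push_cast at hu₀
    rw [huO, hγ]
    linear_combination hu₀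
  refine ⟨a, u, m, Nat.le_of_dvd hn han, by omega, by omega, ?_, ?_, fun x => ⟨fun hx => ?_, ?_⟩⟩
  · have : (u : ℤ) ∈ coeffIdeal α I := ⟨γ * α, I.mul_mem_right _ hγI, -(d * m), by
      push_cast
      linear_combination α * hγ2 + m * h.sq_eq⟩
    exact_mod_cast (hm u).mp this
  · have hmem : (((u ^ 2 + d * m ^ 2 : ℕ) : ℤ) : O) ∈ I := by
      have : (((u ^ 2 + d * m ^ 2 : ℕ) : ℤ) : O) = (4 * (u - γ)) * γ := by
        push_cast
        linear_combination (2 * γ - u + m * α) * hγ2 + (m : O) ^ 2 * h.sq_eq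
      rw [this]
      exact I.mul_mem_left _ hγI
    exact_mod_cast (ha _).mp hmem
  · obtain ⟨u', v', huv⟩ := h.exists_two_mul_eq x
    obtain ⟨t, rfl⟩ := (hm v').mp ⟨x, hx, u', huv⟩
    have h2 : 2 * (x - t * γ) = ((u' - t * u : ℤ) : O) := by
      push_cast at huv ⊢
      linear_combination huv - t * hγ2
    obtain ⟨j, hj⟩ := h.intCast_of_two_mul_eq h2
    have h3 : x - t * γ = j := h.two_mul_cancel (by rw [h2, hj]; push_cast; ring)
    obtain ⟨s, rfl⟩ := (ha j).mp (by rw [← h3]; exact I.sub_mem hx (I.mul_mem_left _ hγI))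
    refine ⟨s, t, ?_⟩
    push_cast at h3
    linear_combination 2 * h3 + t * hγ2
  · rintro ⟨s, t, hx⟩
    have : x = a * s + t * γ := h.two_mul_cancel (by linear_combination hx - t * hγ2)
    rw [this]
    exact I.add_mem (I.mul_mem_right _ haI) (I.mul_mem_left _ hγI)

theorem card_le_sum_divisors [IsDomain O] (h : IsImagQuadOrder d α) {ι : Type*}
    (I : ι → Ideal O) (hI : Function.Injective I) (T : ℕ)
    (hT : ∀ i, ∃ n : ℕ, 0 < n ∧ n ≤ T ∧ (n : O) ∈ I i) :
    Nat.card ι ≤ ∑ u ∈ Icc 1 (2 * T), ∑ m ∈ u.divisors, (u ^ 2 + d * m ^ 2).divisors.card := by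
  have key : ∀ i, ∃ a u m : ℕ, a ≤ T ∧ 1 ≤ u ∧ u ≤ 2 * a ∧ m ∣ u ∧ a ∣ u ^ 2 + d * m ^ 2 ∧
      ∀ x, x ∈ I i ↔ ∃ s t : ℤ, 2 * x = 2 * a * s + t * (u + m * α) := fun i => by
    obtain ⟨n, hn, hnT, hnI⟩ := hT i
    obtain ⟨a, u, m, h1, h2⟩ := h.exists_normal_form (I i) hn hnI
    exact ⟨a, u, m, h1.trans hnT, h2⟩
  choose a u m haT hu1 hu2 hmu hadvd hmem using key
  let S : Finset (Σ _ : ℕ, Σ _ : ℕ, ℕ) := (Icc 1 (2 * T)).sigma fun u =>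
    u.divisors.sigma fun m => (u ^ 2 + d * m ^ 2).divisors
  have hS : ∀ i, (⟨u i, m i, a i⟩ : Σ _ : ℕ, Σ _ : ℕ, ℕ) ∈ S := fun i => by
    simp only [S, mem_sigma, mem_Icc, Nat.mem_divisors]
    have h1 := haT i
    have h2 := hu1 i
    have h3 := hu2 i
    refine ⟨⟨h2, by omega⟩, ⟨hmu i, by omega⟩, hadvd i, ?_⟩
    positivity
  have hcard : S.card = ∑ u ∈ Icc 1 (2 * T), ∑ m ∈ u.divisors,
      (u ^ 2 + d * m ^ 2).divisors.card := by
    simp only [S, card_sigma]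
  rw [← hcard, ← Nat.card_eq_finsetCard]
  refine Nat.card_le_card_of_injective (fun i => (⟨_, hS i⟩ : S)) fun i j hij => hI ?_
  have h1 := congrArg Subtype.val hij
  simp only [Sigma.mk.injEq, heq_eq_eq] at h1
  obtain ⟨h1, h2, h3⟩ := h1
  ext x
  rw [hmem, hmem, h1, h2, h3]

end IsImagQuadOrder

end

section

open Finset NumberField

namespace IsImagQuadOrder

variable {d : ℕ}

section

variable {O : Type*} [CommRing O] {α : O}

theorem discr_eq [IsDomain O] [Module.Free ℤ O] [Module.Finite ℤ O]
    (hO : Module.finrank ℤ O = 2) (h : IsImagQuadOrder d α) :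
    Algebra.discr ℤ ![1, α] = -(4 * d) := by
  obtain ⟨σ, hσ⟩ := h.exists_conj
  have hσσ : ∀ x, σ (σ x) = x := fun x => h.two_mul_cancel (by
    obtain ⟨u, v, huv⟩ := h.exists_two_mul_eq x
    have := congrArg (fun y => σ (σ y)) huv
    simp only [map_mul, map_add, map_ofNat, map_intCast, hσ, map_neg, neg_neg] at this
    rw [this, huv])
  let e : O ≃ₐ[ℤ] O := AlgEquiv.ofRingEquiv
    (f := RingEquiv.ofRingHom σ σ (RingHom.ext hσσ) (RingHom.ext hσσ)) (by simp)
  have hα : Algebra.trace ℤ O α = 0 := by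
    have h1 := Algebra.trace_eq_of_algEquiv e α
    have h2 : e α = -α := hσ
    rw [h2, map_neg] at h1
    omega
  have hint : ∀ n : ℤ, Algebra.trace ℤ O n = 2 * n := fun n => by
    have := Algebra.trace_algebraMap (R := ℤ) (S := O) n
    rw [hO] at this
    simpa using this
  have h1 : Algebra.trace ℤ O 1 = 2 := by simpa using hint 1
  have h2 : Algebra.trace ℤ O (α * α) = -(2 * d) := by
    rw [← sq, h.sq_eq]
    simpa using hint (-d)
  rw [Algebra.discr_def, Matrix.det_fin_two]
  simp [Algebra.traceMatrix_apply, Algebra.traceForm_apply, hα, h1, h2]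
  ring

end

section

variable {K : Type*} [Field K] [NumberField K] {α : 𝓞 K}

theorem natAbs_discr_le (hd : d ≠ 0) (hK : Module.finrank ℚ K = 2) (h : IsImagQuadOrder d α) :
    (discr K).natAbs ≤ 4 * d := by
  have hO : Module.finrank ℤ (𝓞 K) = 2 := by rw [RingOfIntegers.rank, hK]
  let b := Module.finBasisOfFinrankEq ℤ (𝓞 K) hO
  have hb : Algebra.discr ℤ ![1, α] = (b.toMatrix ![1, α]).det ^ 2 * discr K := by
    rw [← NumberField.discr_eq_discr K b, ← Algebra.discr_of_matrix_vecMul,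
      Module.Basis.toMatrix_map_vecMul]
  rw [h.discr_eq hO] at hb
  have h2 := congrArg Int.natAbs hb
  have h3 : (4 * (d : ℤ)).natAbs = 4 * d := by omega
  rw [Int.natAbs_neg, h3, Int.natAbs_mul] at h2
  rw [h2]
  refine Nat.le_mul_of_pos_left _ (Nat.pos_of_ne_zero fun h0 => ?_)
  rw [h0] at h2
  omega

theorem exists_natCast_mem_of_class (hd : d ≠ 0) (hK : Module.finrank ℚ K = 2)
    (h : IsImagQuadOrder d α) (c : ClassGroup (𝓞 K)) :
    ∃ I : nonZeroDivisors (Ideal (𝓞 K)), ClassGroup.mk0 I = c ∧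
      ∃ n : ℕ, 0 < n ∧ n ≤ 2 * d.sqrt + 2 ∧ (n : 𝓞 K) ∈ (I : Ideal (𝓞 K)) := by
  obtain ⟨I, hI, hn⟩ := exists_ideal_in_class_of_norm_le c
  refine ⟨I, hI, Ideal.absNorm (I : Ideal (𝓞 K)), ?_, ?_, Ideal.absNorm_mem _⟩
  · exact Nat.pos_of_ne_zero (Ideal.absNorm_eq_zero_iff.not.mpr (nonZeroDivisors.ne_zero I.2))
  have hc : InfinitePlace.nrComplexPlaces K ≤ 1 := by
    have := InfinitePlace.card_add_two_mul_card_eq_rank K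
    omega
  have h4π : 1 ≤ 4 / Real.pi := (one_le_div Real.pi_pos).mpr Real.pi_le_four
  have h4π2 : 4 / Real.pi ≤ 2 := by
    rw [div_le_iff₀ Real.pi_pos]
    linarith [Real.pi_gt_three]
  have hpow : (4 / Real.pi) ^ InfinitePlace.nrComplexPlaces K ≤ 2 :=
    (pow_le_pow_right₀ h4π hc).trans (by simpa using h4π2)
  have hdisc : √|(discr K : ℝ)| ≤ 2 * √d := by
    rw [Real.sqrt_le_left (by positivity), mul_pow, Real.sq_sqrt (by positivity)]
    have := h.natAbs_discr_le hd hK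
    have h2 : ((discr K).natAbs : ℝ) = |(discr K : ℝ)| := by
      rw [Nat.cast_natAbs]; push_cast; rfl
    rw [← h2]
    have h3 : ((discr K).natAbs : ℝ) ≤ ((4 * d : ℕ) : ℝ) := by exact_mod_cast this
    push_cast at h3
    linarith
  have hs : √(d : ℝ) ≤ d.sqrt + 1 := Real.sqrt_le_left (by positivity) |>.mpr (by
    have := Nat.lt_succ_sqrt d
    have h2 : (d : ℝ) ≤ ((d.sqrt.succ * d.sqrt.succ : ℕ) : ℝ) := by exact_mod_cast this.le
    push_cast at h2
    linarith)
  rw [hK] at hn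
  have : ((Ideal.absNorm (I : Ideal (𝓞 K)) : ℕ) : ℝ) ≤ ((2 * d.sqrt + 2 : ℕ) : ℝ) := by
    refine hn.trans ?_
    calc _ ≤ 2 * (((2).factorial : ℝ) / (2 : ℕ) ^ 2 * √|(discr K : ℝ)|) := by gcongr
      _ = √|(discr K : ℝ)| := by norm_num [Nat.factorial]; ring
      _ ≤ 2 * √d := hdisc
      _ ≤ _ := by push_cast; linarith
  exact_mod_cast this

theorem card_classGroup_le_sum (hd : d ≠ 0) (hK : Module.finrank ℚ K = 2)
    (h : IsImagQuadOrder d α) : Nat.card (ClassGroup (𝓞 K)) ≤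
      ∑ u ∈ Icc 1 (2 * (2 * d.sqrt + 2)), ∑ m ∈ u.divisors,
        (u ^ 2 + d * m ^ 2).divisors.card := by
  choose I hI hn using h.exists_natCast_mem_of_class hd hK
  refine h.card_le_sum_divisors (fun c => (I c : Ideal (𝓞 K))) (fun c c' hcc => ?_) _ hn
  rw [← hI c, ← hI c', Subtype.ext hcc]

end

end IsImagQuadOrder

/-- The class number of `ℚ(√-d)` is at most `d ^ (1 / 2 + δ)` up to a constant. -/
theorem exists_card_classGroup_le {δ : ℝ} (hδ : 0 < δ) : ∃ C : ℝ, 1 ≤ C ∧ ∀ (d : ℕ), d ≠ 0 →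
    ∀ (K : Type) [Field K] [NumberField K] (α : 𝓞 K), Module.finrank ℚ K = 2 →
    IsImagQuadOrder d α → (Nat.card (ClassGroup (𝓞 K)) : ℝ) ≤ C * (d : ℝ) ^ (1 / 2 + δ) := by
  obtain ⟨C, hC, hdiv⟩ := exists_card_divisors_le_rpow (δ := δ / 4) (by positivity)
  refine ⟨8 * (C * (128 : ℝ) ^ (δ / 4)) ^ 2, ?_, fun d hd K _ _ α hK h => ?_⟩
  · have h1 : (1 : ℝ) ≤ 128 ^ (δ / 4) := Real.one_le_rpow (by norm_num) (by positivity)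
    have h2 : 1 ≤ C * (128 : ℝ) ^ (δ / 4) := one_le_mul_of_one_le_of_one_le hC h1
    nlinarith
  have hd1 : (1 : ℝ) ≤ d := by exact_mod_cast Nat.one_le_iff_ne_zero.mpr hd
  have hs1 : 1 ≤ d.sqrt := Nat.sqrt_pos.mpr (Nat.pos_of_ne_zero hd)
  have hsd : d.sqrt ^ 2 ≤ d := Nat.sqrt_le' d
  set D : ℝ := C * (128 : ℝ) ^ (δ / 4) * (d : ℝ) ^ (δ / 2) with hD
  have hdivle : ∀ n : ℕ, n ≠ 0 → n ≤ 128 * d ^ 2 → (n.divisors.card : ℝ) ≤ D := fun n hn hle => by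
    refine (hdiv n hn).trans ?_
    have h1 : (n : ℝ) ≤ 128 * (d : ℝ) ^ 2 := by exact_mod_cast hle
    calc C * (n : ℝ) ^ (δ / 4) ≤ C * (128 * (d : ℝ) ^ 2) ^ (δ / 4) := by gcongr
      _ = D := by
        rw [Real.mul_rpow (by norm_num) (by positivity), ← Real.rpow_natCast,
          ← Real.rpow_mul (by positivity), hD, mul_assoc]
        congr 3
        push_cast
        ring
  have hD0 : 0 ≤ D := by positivity
  have hnat := h.card_classGroup_le_sum hd hK
  have hsum : (Nat.card (ClassGroup (𝓞 K)) : ℝ) ≤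
      ∑ u ∈ Icc 1 (2 * (2 * d.sqrt + 2)), D * D := by
    calc _ ≤ ((∑ u ∈ Icc 1 (2 * (2 * d.sqrt + 2)), ∑ m ∈ u.divisors,
          (u ^ 2 + d * m ^ 2).divisors.card : ℕ) : ℝ) := by exact_mod_cast hnat
      _ = ∑ u ∈ Icc 1 (2 * (2 * d.sqrt + 2)), ∑ m ∈ u.divisors,
          ((u ^ 2 + d * m ^ 2).divisors.card : ℝ) := by push_cast; rfl
      _ ≤ _ := by
        refine sum_le_sum fun u hu => ?_
        rw [mem_Icc] at hu
        have hu2 : u ≤ 8 * d.sqrt := by omega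
        have husq : u ^ 2 ≤ 64 * d := by
          calc u ^ 2 ≤ (8 * d.sqrt) ^ 2 := by gcongr
            _ = 64 * d.sqrt ^ 2 := by ring
            _ ≤ 64 * d := by gcongr
        have hdd : d ≤ d ^ 2 := Nat.le_self_pow two_ne_zero d
        calc ∑ m ∈ u.divisors, ((u ^ 2 + d * m ^ 2).divisors.card : ℝ)
            ≤ ∑ m ∈ u.divisors, D := by
              refine sum_le_sum fun m hm => hdivle _ ?_ ?_
              · have : 0 < u ^ 2 := by have := hu.1; positivity
                omega
              · have hmu : m ≤ u := Nat.divisor_le hm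
                calc u ^ 2 + d * m ^ 2 ≤ 64 * d + d * (64 * d) := by
                      gcongr
                      exact (Nat.pow_le_pow_left hmu 2).trans husq
                  _ ≤ 128 * d ^ 2 := by nlinarith
          _ = u.divisors.card * D := by rw [sum_const, nsmul_eq_mul]
          _ ≤ D * D := by
            gcongr
            refine hdivle u (by omega) ?_
            have : u ≤ u ^ 2 := Nat.le_self_pow two_ne_zero u
            nlinarith
  refine hsum.trans ?_
  rw [sum_const, nsmul_eq_mul, Nat.card_Icc]
  have hroot : (d.sqrt : ℝ) ≤ (d : ℝ) ^ (1 / 2 : ℝ) := by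
    rw [← Real.sqrt_eq_rpow]
    exact Real.nat_sqrt_le_real_sqrt
  have hcount : ((2 * (2 * d.sqrt + 2) + 1 - 1 : ℕ) : ℝ) ≤ 8 * (d : ℝ) ^ (1 / 2 : ℝ) := by
    have : 2 * (2 * d.sqrt + 2) + 1 - 1 ≤ 8 * d.sqrt := by omega
    calc ((2 * (2 * d.sqrt + 2) + 1 - 1 : ℕ) : ℝ) ≤ ((8 * d.sqrt : ℕ) : ℝ) := by exact_mod_cast this
      _ = 8 * d.sqrt := by push_cast; rfl
      _ ≤ _ := by gcongr
  calc _ ≤ 8 * (d : ℝ) ^ (1 / 2 : ℝ) * (D * D) := by gcongr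
    _ = _ := by
      rw [Real.rpow_add (by positivity), hD]
      have : (d : ℝ) ^ δ = (d : ℝ) ^ (δ / 2) * (d : ℝ) ^ (δ / 2) := by
        rw [← Real.rpow_add (by positivity), add_halves]
      rw [this]
      ring

end

section

namespace Kneg
open NumberField Polynomial

/-- The generator `√d · i` of `ℚ(√-d)`. -/
noncomputable def gen (d : ℕ) : ℂ := (Real.sqrt d : ℂ) * Complex.I

variable {d : ℕ}

theorem gen_sq (d : ℕ) : gen d ^ 2 = -(d : ℂ) := by
  rw [gen, mul_pow, Complex.I_sq, ← Complex.ofReal_pow, Real.sq_sqrt (by positivity)]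
  simp

theorem isIntegral_gen (R : Type*) [CommRing R] [Algebra R ℂ] (d : ℕ) : IsIntegral R (gen d) := by
  refine ⟨X ^ 2 + C (d : R), monic_X_pow_add_C _ two_ne_zero, ?_⟩
  simp [gen_sq]

instance (d : ℕ) : NumberField (Kneg d) where
  to_finiteDimensional := IntermediateField.adjoin.finiteDimensional (isIntegral_gen ℚ d)

theorem gen_mem (d : ℕ) : gen d ∈ Kneg d :=
  IntermediateField.mem_adjoin_simple_self ℚ (gen d)

theorem exists_eq_add {x : ℂ} (hx : x ∈ Kneg d) : ∃ r s : ℚ, x = r + s * gen d := by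
  have h1 : x ∈ Algebra.adjoin ℚ {gen d} := by
    rw [← IntermediateField.adjoin_simple_toSubalgebra_of_isAlgebraic
      (isIntegral_gen ℚ d).isAlgebraic]
    exact hx
  clear hx
  induction h1 using Algebra.adjoin_induction with
  | mem x hx => exact ⟨0, 1, by simpa using hx⟩
  | algebraMap r => exact ⟨r, 0, by simp⟩
  | add x y _ _ hx hy =>
    obtain ⟨r, s, rfl⟩ := hx
    obtain ⟨r', s', rfl⟩ := hy
    exact ⟨r + r', s + s', by push_cast; ring⟩
  | mul x y _ _ hx hy =>
    obtain ⟨r, s, rfl⟩ := hx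
    obtain ⟨r', s', rfl⟩ := hy
    exact ⟨r * r' - d * (s * s'), r * s' + s * r', by
      push_cast
      linear_combination (s * s' : ℂ) * gen_sq d⟩

theorem conj_gen (d : ℕ) : starRingEnd ℂ (gen d) = -gen d := by
  simp [gen]

theorem conj_add (r s : ℚ) : starRingEnd ℂ (r + s * gen d) = r - s * gen d := by
  rw [map_add, map_mul, conj_gen]
  simp [sub_eq_add_neg]

theorem conj_mem {x : ℂ} (hx : x ∈ Kneg d) : starRingEnd ℂ x ∈ Kneg d := by
  obtain ⟨r, s, rfl⟩ := exists_eq_add hx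
  rw [conj_add]
  exact sub_mem (SubfieldClass.ratCast_mem _ r)
    (mul_mem (SubfieldClass.ratCast_mem _ s) (gen_mem d))

/-- Complex conjugation on `ℚ(√-d)`. -/
noncomputable def conj (d : ℕ) : Kneg d →+* Kneg d :=
  ((starRingEnd ℂ).comp (algebraMap (Kneg d) ℂ)).codRestrict (Kneg d) fun x => conj_mem x.2

theorem eq_zero_of_intCast_add (hd : d ≠ 0) {a b : ℝ} (h : (a : ℂ) + b * gen d = 0) :
    a = 0 ∧ b = 0 := by
  have h1 := congrArg Complex.re h
  have h2 := congrArg Complex.im h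
  simp [gen, hd] at h1 h2
  exact ⟨h1, h2⟩

theorem finrank_eq (hd : d ≠ 0) : Module.finrank ℚ (Kneg d) = 2 := by
  have h1 : Module.finrank ℚ (Kneg d) = (minpoly ℚ (gen d)).natDegree :=
    IntermediateField.adjoin.finrank (isIntegral_gen ℚ d)
  rw [h1]
  apply le_antisymm
  · have hp : (X ^ 2 + C (d : ℚ)).natDegree = 2 := natDegree_X_pow_add_C
    rw [← hp]
    refine natDegree_le_of_dvd (minpoly.dvd ℚ _ (by simp [gen_sq])) ?_
    exact (monic_X_pow_add_C _ two_ne_zero).ne_zero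
  · rw [minpoly.two_le_natDegree_iff (isIntegral_gen ℚ d)]
    rintro ⟨r, hr⟩
    have := (eq_zero_of_intCast_add hd (a := r) (b := -1) (by
      push_cast
      rw [← hr]
      simp)).2
    norm_num at this

theorem exists_int_of_isIntegral {q : ℚ} {z : ℂ} (hz : IsIntegral ℤ z) (hq : z = q) :
    ∃ n : ℤ, q = n := by
  have h1 : IsIntegral ℤ (algebraMap ℚ ℂ q) := by simpa [hq] using hz
  rw [isIntegral_algebraMap_iff (algebraMap ℚ ℂ).injective] at h1
  obtain ⟨n, hn⟩ := IsIntegrallyClosed.isIntegral_iff.mp h1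
  exact ⟨n, by simpa using hn.symm⟩

theorem exists_int_of_sq_mul (hd : Squarefree d) {q : ℚ} {n : ℤ} (h : q ^ 2 * d = n) :
    ∃ m : ℤ, q = m := by
  have h1 : q.num ^ 2 * d = n * (q.den : ℤ) ^ 2 := by
    have h2 : (q.den : ℚ) ≠ 0 := by exact_mod_cast q.den_nz
    rw [← Rat.num_div_den q, div_pow, div_mul_eq_mul_div, div_eq_iff (by positivity)] at h
    exact_mod_cast h
  have h2 : (q.den : ℤ) ^ 2 ∣ q.num ^ 2 * d := ⟨n, by rw [h1, mul_comm]⟩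
  have h3 : IsCoprime ((q.den : ℤ) ^ 2) (q.num ^ 2) := by
    apply IsCoprime.pow
    rw [Int.isCoprime_iff_gcd_eq_one, Int.gcd_comm]
    exact q.reduced
  have h4 : q.den ^ 2 ∣ d := by exact_mod_cast h3.dvd_of_dvd_mul_left h2
  have h5 : q.den = 1 := Nat.isUnit_iff.mp (hd _ (by rwa [← sq]))
  exact ⟨q.num, (Rat.coe_int_num_of_den_eq_one h5).symm⟩

/-- The generator `√d · i` as an algebraic integer. -/
noncomputable def intGen (d : ℕ) : 𝓞 (Kneg d) :=
  ⟨⟨gen d, gen_mem d⟩, by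
    rw [mem_integralClosure_iff, ← isIntegral_algebraMap_iff (algebraMap (Kneg d) ℂ).injective]
    exact isIntegral_gen ℤ d⟩

@[simp]
theorem coe_intGen (d : ℕ) : ((intGen d : Kneg d) : ℂ) = gen d := rfl

@[simp]
theorem coe_conj (x : Kneg d) : (conj d x : ℂ) = starRingEnd ℂ x := rfl

theorem coe_injective : Function.Injective fun x : 𝓞 (Kneg d) => ((x : Kneg d) : ℂ) :=
  fun _ _ h => RingOfIntegers.ext (Subtype.ext h)

theorem isImagQuadOrder (hd : Squarefree d) : IsImagQuadOrder d (intGen d) where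
  sq_eq := coe_injective (by simpa using gen_sq d)
  indep a b h := by
    have h1 := congrArg (fun x : 𝓞 (Kneg d) => ((x : Kneg d) : ℂ)) h
    have := eq_zero_of_intCast_add hd.ne_zero (a := a) (b := b) (by simpa using h1)
    exact_mod_cast this
  exists_two_mul_eq x := by
    obtain ⟨r, s, hx⟩ := exists_eq_add (x : Kneg d).2
    have hint : IsIntegral ℤ ((x : Kneg d) : ℂ) := (RingOfIntegers.isIntegral_coe x).algebraMap
    have hconj : IsIntegral ℤ (starRingEnd ℂ ((x : Kneg d) : ℂ)) :=
      hint.map (starRingEnd ℂ).toIntAlgHom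
    rw [hx] at hint hconj
    rw [conj_add] at hconj
    obtain ⟨u, hu⟩ := exists_int_of_isIntegral (q := 2 * r) (hint.add hconj) (by push_cast; ring)
    obtain ⟨n, hn⟩ := exists_int_of_isIntegral (q := -((2 * s) ^ 2 * d)) ((hint.sub hconj).pow 2) (by
      push_cast
      linear_combination 4 * (s : ℂ) ^ 2 * gen_sq d)
    obtain ⟨v, hv⟩ := exists_int_of_sq_mul hd (q := 2 * s) (n := -n) (by
      push_cast
      linarith)
    refine ⟨u, v, coe_injective ?_⟩
    have hu' : (2 * r : ℂ) = u := by exact_mod_cast congrArg (Rat.cast (K := ℂ)) hu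
    have hv' : (2 * s : ℂ) = v := by exact_mod_cast congrArg (Rat.cast (K := ℂ)) hv
    have : 2 * ((x : Kneg d) : ℂ) = u + v * gen d := by
      rw [hx]
      linear_combination hu' + gen d * hv'
    have h2 : ((2 : 𝓞 (Kneg d)) : Kneg d) = 2 := map_ofNat _ 2
    have h3 : ((2 : Kneg d) : ℂ) = 2 := rfl
    simpa [h2, h3] using this
  exists_conj := ⟨RingOfIntegers.mapRingHom (conj d), coe_injective (by
    simpa using conj_gen d)⟩

end Kneg

end

section

open Finset NumberField NumberTheorySymbols

/-- The Cauchy–Schwarz lower bound for the number of collisions of a map. -/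
theorem card_sq_le_card_image_mul_card_collisions {ι κ : Type*} [DecidableEq κ]
    (P : Finset ι) (f : ι → κ) :
    P.card ^ 2 ≤ (P.image f).card * ((P ×ˢ P).filter fun x => f x.1 = f x.2).card := by
  have h1 : P.card = ∑ c ∈ P.image f, (P.filter fun a => f a = c).card :=
    card_eq_sum_card_image f P
  have h2 : ((P ×ˢ P).filter fun x => f x.1 = f x.2).card =
      ∑ c ∈ P.image f, (P.filter fun a => f a = c).card ^ 2 := by
    rw [card_eq_sum_card_fiberwise (f := fun x : ι × ι => f x.1) (t := P.image f)]
    · refine sum_congr rfl fun c _ => ?_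
      rw [sq, ← card_product, filter_filter]
      congr 1
      ext x
      simp only [mem_filter, mem_product]
      constructor
      · rintro ⟨⟨h1, h2⟩, h3, h4⟩
        exact ⟨⟨h1, h4⟩, h2, h3 ▸ h4⟩
      · rintro ⟨⟨h1, h4⟩, h2, h3⟩
        exact ⟨⟨h1, h2⟩, h4.trans h3.symm, h4⟩
    · intro x hx
      exact mem_coe.mpr (mem_image_of_mem f (mem_product.mp (mem_filter.mp (mem_coe.mp hx)).1).1)
  calc P.card ^ 2 = (∑ c ∈ P.image f, (P.filter fun a => f a = c).card) ^ 2 := by rw [← h1]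
    _ ≤ _ := sq_sum_le_card_mul_sum_sq
    _ = _ := by rw [← h2, Nat.cast_id]

theorem exists_dvd_sq_add_of_jacobiSym_eq_one {p d : ℕ} (hp : p.Prime) (hp2 : p ≠ 2)
    (h : J(-(d : ℤ) | p) = 1) : ∃ t : ℤ, (p : ℤ) ∣ t ^ 2 + d ∧ IsCoprime (p : ℤ) (2 * t) := by
  have := Fact.mk hp
  obtain ⟨s, hs⟩ := ZMod.isSquare_of_jacobiSym_eq_one h
  obtain ⟨t, rfl⟩ := ZMod.intCast_surjective s
  have hdvd : (p : ℤ) ∣ t ^ 2 + d := by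
    rw [← ZMod.intCast_zmod_eq_zero_iff_dvd]
    push_cast at hs ⊢
    linear_combination -hs
  have hpi := Nat.prime_iff_prime_int.mp hp
  refine ⟨t, hdvd, (Prime.coprime_iff_not_dvd hpi).mpr fun hdiv => ?_⟩
  rcases hpi.dvd_or_dvd hdiv with h2 | ht
  · exact hp2 ((Nat.prime_dvd_prime_iff_eq hp Nat.prime_two).mp (by exact_mod_cast h2))
  · have hpd : (p : ℤ) ∣ d := (dvd_add_right (dvd_pow ht two_ne_zero)).mp hdvd
    have : J(-(d : ℤ) | p) = 0 := by
      rw [jacobiSym.mod_left, Int.emod_eq_zero_of_dvd (dvd_neg.mpr hpd)]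
      exact jacobiSym.zero_left hp.one_lt
    omega

theorem card_mul_hneg (g d : ℕ) :
    Nat.card (powMonoidHom g : ClassGroup (𝓞 (Kneg d)) →* _).range * hneg g d =
      Nat.card (ClassGroup (𝓞 (Kneg d))) := by
  rw [← Subgroup.index_ker, mul_comm]
  exact Subgroup.card_mul_index (powMonoidHom g : ClassGroup (𝓞 (Kneg d)) →* _).ker

open Classical in
/-- If the `g`-part of the class number is large, then many pairs of split primes yield
representations of `4 (p q) ^ g` by the norm form. -/
theorem card_sq_mul_hneg_le {g d : ℕ} (hd : Squarefree d) (hg : g ≠ 0) (P : Finset ℕ)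
    (hP : ∀ p ∈ P, p.Prime ∧ p ≠ 2 ∧ J(-(d : ℤ) | p) = 1) :
    P.card ^ 2 * hneg g d ≤ Nat.card (ClassGroup (𝓞 (Kneg d))) *
      ((P.offDiag.filter fun x => ∃ u v : ℕ, v.Coprime (x.1 * x.2) ∧
        4 * (x.1 * x.2) ^ g = u ^ 2 + d * v ^ 2).card + P.card) := by
  have hI := Kneg.isImagQuadOrder hd
  have key : ∀ p : ℕ, ∃ t : ℤ, p ∈ P → (p : ℤ) ∣ t ^ 2 + d ∧ IsCoprime (p : ℤ) (2 * t) := fun p => by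
    by_cases hp : p ∈ P
    · obtain ⟨t, ht⟩ := exists_dvd_sq_add_of_jacobiSym_eq_one (hP p hp).1 (hP p hp).2.1 (hP p hp).2.2
      exact ⟨t, fun _ => ht⟩
    · exact ⟨0, fun h => absurd h hp⟩
  choose t ht using key
  have hne : ∀ p ∈ P, IsImagQuadOrder.idl (Kneg.intGen d) p (t p) ∈
      nonZeroDivisors (Ideal (𝓞 (Kneg d))) := fun p hp => by
    refine mem_nonZeroDivisors_of_ne_zero fun h0 => (hP p hp).1.ne_zero ?_
    have := IsImagQuadOrder.natCast_mem_idl (α := Kneg.intGen d) p (t p)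
    rw [h0] at this
    exact_mod_cast (show ((p : ℕ) : 𝓞 (Kneg d)) = 0 from this)
  let f : ℕ → ClassGroup (𝓞 (Kneg d)) := fun p =>
    if hp : p ∈ P then ClassGroup.mk0 ⟨_, hne p hp⟩ ^ g else 1
  have himage : (P.image f).card ≤
      Nat.card (powMonoidHom g : ClassGroup (𝓞 (Kneg d)) →* _).range := by
    rw [← Nat.card_eq_finsetCard]
    refine Nat.card_le_card_of_injective (fun c => ⟨c.1, ?_⟩) fun c c' h =>
      Subtype.ext (Subtype.mk.inj h)
    obtain ⟨p, hp, hpc⟩ := mem_image.mp c.2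
    exact ⟨ClassGroup.mk0 ⟨_, hne p hp⟩, by rw [← hpc]; simp [f, hp]⟩
  have hcoll : ((P ×ˢ P).filter fun x => f x.1 = f x.2).card ≤
      (P.offDiag.filter fun x => ∃ u v : ℕ, v.Coprime (x.1 * x.2) ∧
        4 * (x.1 * x.2) ^ g = u ^ 2 + d * v ^ 2).card + P.card := by
    rw [← diag_card P]
    refine (card_le_card fun x hx => ?_).trans (card_union_le _ _)
    rw [mem_filter, mem_product] at hx
    obtain ⟨⟨hx1, hx2⟩, hf⟩ := hx
    rw [mem_union, mem_filter, mem_offDiag, mem_diag]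
    rcases eq_or_ne x.1 x.2 with he | hne'
    · exact Or.inr ⟨hx1, he⟩
    · refine Or.inl ⟨⟨hx1, hx2, hne'⟩, ?_⟩
      simp only [f, hx1, hx2, dif_pos] at hf
      exact hI.exists_four_mul_pow_eq (hP _ hx1).1 (hP _ hx2).1 (hP _ hx1).2.1 (hP _ hx2).2.1 hne' hg
        (ht _ hx1).1 (ht _ hx2).1 (ht _ hx1).2 (ht _ hx2).2 _ _ hf
  calc P.card ^ 2 * hneg g d
      ≤ (Nat.card (powMonoidHom g : ClassGroup (𝓞 (Kneg d)) →* _).range * _) * hneg g d := by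
        gcongr
        exact (card_sq_le_card_image_mul_card_collisions P f).trans
          (Nat.mul_le_mul himage hcoll)
    _ = _ := by
        rw [← card_mul_hneg g d]
        ring

end

section

open Finset NumberTheorySymbols Filter

theorem card_oddPrimesLE_le (y : ℕ) : (oddPrimesLE y).card ≤ y := by
  have : oddPrimesLE y ⊆ Icc 1 y := fun p hp => by
    rw [mem_oddPrimesLE] at hp
    exact mem_Icc.mpr ⟨hp.2.1.one_lt.le, hp.1⟩
  simpa using card_le_card this

theorem eventually_le_card_oddPrimesLE {δ κ : ℝ} (hδ : 0 < δ) (hκ : 0 < κ) :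
    ∀ᶠ X : ℝ in atTop, ∀ Y : ℝ, X ^ κ ≤ Y → Y ≤ X →
      Y * X ^ (-(2 * δ)) ≤ ((oddPrimesLE ⌊Y⌋₊).card : ℝ) := by
  obtain ⟨c, hc, N, hN⟩ := exists_le_card_oddPrimesLE hδ
  filter_upwards [(tendsto_rpow_atTop hκ).eventually_ge_atTop ((N : ℝ) + 1),
    (tendsto_rpow_atTop hδ).eventually_ge_atTop (2 / c), eventually_ge_atTop 1]
    with X hX1 hX2 hX3 Y hY1 hY2
  have hX0 : 0 < X := by linarith
  have hN0 : (0 : ℝ) ≤ N := by positivity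
  have hY0 : 1 ≤ Y := by linarith
  have hfl : Y / 2 ≤ (⌊Y⌋₊ : ℝ) := by
    have h1 := Nat.lt_floor_add_one Y
    have h2 : (1 : ℝ) ≤ ⌊Y⌋₊ := by exact_mod_cast Nat.le_floor (by simpa using hY0)
    linarith
  have hfl0 : (0 : ℝ) < ⌊Y⌋₊ := by linarith
  have hfX : (⌊Y⌋₊ : ℝ) ≤ X := (Nat.floor_le (by linarith)).trans hY2
  refine le_trans ?_ (hN ⌊Y⌋₊ (Nat.le_floor (by linarith)))
  have h3 : X ^ (-δ) ≤ (⌊Y⌋₊ : ℝ) ^ (-δ) :=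
    Real.rpow_le_rpow_of_nonpos hfl0 hfX (by linarith)
  have h4 : X ^ (-(2 * δ)) = X ^ (-δ) * X ^ (-δ) := by
    rw [← Real.rpow_add hX0]
    ring_nf
  have h5 : X ^ (-δ) ≤ c / 2 := by
    rw [Real.rpow_neg hX0.le, inv_le_comm₀ (by positivity) (by positivity), inv_div]
    exact hX2
  have h6 : (⌊Y⌋₊ : ℝ) ^ (1 - δ) = ⌊Y⌋₊ * (⌊Y⌋₊ : ℝ) ^ (-δ) := by
    rw [sub_eq_add_neg, Real.rpow_add hfl0, Real.rpow_one]
  rw [h6, h4]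
  calc Y * (X ^ (-δ) * X ^ (-δ)) ≤ Y * (c / 2 * X ^ (-δ)) := by gcongr
    _ = c * (Y / 2 * X ^ (-δ)) := by ring
    _ ≤ _ := by gcongr

theorem sum_inv_Icc_le (V : ℕ) : ∑ v ∈ Icc 1 V, (v : ℝ)⁻¹ ≤ 1 + Real.log V := by
  have := harmonic_le_one_add_log V
  rw [harmonic_eq_sum_Icc] at this
  push_cast at this
  exact this

theorem eventually_card_le_of_four_mul_pow_eq (g : ℕ) {δ : ℝ} (hδ : 0 < δ) :
    ∀ᶠ X : ℝ in atTop, ∀ Y : ℝ, 0 ≤ Y → Y ≤ X → ∀ D : Finset ℕ,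
      (∀ d ∈ D, X ≤ d ∧ (d : ℝ) < 2 * X) → ∀ k : ℕ, (k : ℝ) ≤ Y ^ 2 →
      (∀ d ∈ D, ∃ u v : ℕ, 0 < v ∧ v.Coprime k ∧ 4 * k ^ g = u ^ 2 + d * v ^ 2) →
      (D.card : ℝ) ≤ X ^ (2 * δ) * (√X + 2 * Y ^ g / √X) := by
  obtain ⟨C, hC, hdiv⟩ := exists_card_divisors_le_rpow
    (δ := δ / (4 * (2 * g + 1))) (by positivity)
  have hlog : ∀ᶠ X : ℝ in atTop, 32 * (1 + (g + 1) * Real.log X) ≤ X ^ δ := by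
    have h1 := (isLittleO_log_rpow_atTop hδ).bound
      (show (0 : ℝ) < 1 / (64 * (g + 1)) by positivity)
    filter_upwards [h1, (tendsto_rpow_atTop hδ).eventually_ge_atTop 64, eventually_ge_atTop 1]
      with X hX1 hX2 hX3
    rw [Real.norm_of_nonneg (Real.log_nonneg hX3), Real.norm_of_nonneg (by positivity),
      one_div_mul_eq_div, le_div_iff₀ (by positivity)] at hX1
    linarith
  filter_upwards [hlog, (tendsto_rpow_atTop (half_pos hδ)).eventually_ge_atTop (C ^ 2),
    eventually_ge_atTop 4] with X hXlog hXC hX4 Y hY0 hYX D hD k hk hrep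
  have hX0 : 0 < X := by linarith
  have hsq : 0 < √X := Real.sqrt_pos.mpr hX0
  have hsq1 : 1 ≤ √X := Real.one_le_sqrt.mpr (by linarith)
  have hsqX : √X ^ 2 = X := Real.sq_sqrt hX0.le
  have hYg : Y ^ g ≤ X ^ g := by gcongr
  have hXδ : 1 ≤ X ^ δ := Real.one_le_rpow (by linarith) hδ.le
  set W : ℝ := 2 * Y ^ g / √X with hW
  have hW0 : 0 ≤ W := by positivity
  have hWX : W ≤ 2 * X ^ g := by
    rw [hW, div_le_iff₀ hsq]
    nlinarith [pow_nonneg hX0.le g]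
  set V : ℕ := ⌊W⌋₊ with hV
  have hVW : (V : ℝ) ≤ W := Nat.floor_le hW0
  set N : ℕ := ⌈√X⌉₊ with hN
  have hN1 : √X ≤ N := Nat.le_ceil _
  have hN2 : (N : ℝ) ≤ 2 * √X := by
    have := Nat.ceil_lt_add_one hsq.le
    linarith
  have hNX : X ≤ (N : ℝ) ^ 2 := by rw [← hsqX]; gcongr
  have main := card_le_sum_of_four_mul_pow_eq (k := k) (g := g) (N := N) (V := V) (D := D) ?_ ?_
  · refine main.trans ?_
    calc ∑ v ∈ Icc 1 V, ((v ^ 2).divisors.card : ℝ) ^ 2 * (16 * N / v + 1)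
        ≤ ∑ v ∈ Icc 1 V, X ^ δ * (16 * N / v + 1) := by
          refine sum_le_sum fun v hv => ?_
          rw [mem_Icc] at hv
          gcongr
          have hvX : ((v ^ 2 : ℕ) : ℝ) ≤ X ^ (2 * g + 1) := by
            have h1 : (v : ℝ) ≤ 2 * X ^ g :=
              le_trans (by exact_mod_cast hv.2) (hVW.trans hWX)
            push_cast
            calc (v : ℝ) ^ 2 ≤ (2 * X ^ g) ^ 2 := by gcongr
              _ = X ^ (2 * g) * 4 := by ring
              _ ≤ X ^ (2 * g) * X := by gcongr
              _ = _ := by ring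
          have h2 : ((v ^ 2).divisors.card : ℝ) ≤ C * X ^ (δ / 4) := by
            refine (hdiv _ (pow_ne_zero 2 (by omega))).trans ?_
            calc C * ((v ^ 2 : ℕ) : ℝ) ^ (δ / (4 * (2 * g + 1)))
                ≤ C * (X ^ (2 * g + 1)) ^ (δ / (4 * (2 * g + 1))) := by gcongr
              _ = C * X ^ (δ / 4) := by
                rw [← Real.rpow_natCast, ← Real.rpow_mul hX0.le]
                congr 2
                push_cast
                field_simp
          calc ((v ^ 2).divisors.card : ℝ) ^ 2 ≤ (C * X ^ (δ / 4)) ^ 2 := by gcongr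
            _ = C ^ 2 * X ^ (δ / 2) := by
              rw [mul_pow, ← Real.rpow_natCast (X ^ (δ / 4)), ← Real.rpow_mul hX0.le]
              congr 2
              push_cast
              ring
            _ ≤ X ^ (δ / 2) * X ^ (δ / 2) := by gcongr
            _ = X ^ δ := by rw [← Real.rpow_add hX0, add_halves]
      _ = X ^ δ * (16 * N * ∑ v ∈ Icc 1 V, (v : ℝ)⁻¹ + V) := by
          rw [← mul_sum, sum_add_distrib, mul_sum]
          simp [div_eq_mul_inv]
      _ ≤ X ^ δ * (X ^ δ * √X + X ^ δ * W) := by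
          refine mul_le_mul_of_nonneg_left (add_le_add ?_ ?_) (by positivity)
          · have hlogV : Real.log V ≤ (g + 1) * Real.log X := by
              rcases Nat.eq_zero_or_pos V with h0 | hpos
              · rw [h0, Nat.cast_zero, Real.log_zero]
                have := Real.log_nonneg (show 1 ≤ X by linarith)
                positivity
              · have h1 : (V : ℝ) ≤ X ^ (g + 1) := by
                  calc (V : ℝ) ≤ 2 * X ^ g := hVW.trans hWX
                    _ ≤ X * X ^ g := by gcongr; linarith
                    _ = _ := by ring
                calc Real.log V ≤ Real.log (X ^ (g + 1)) :=
                      Real.log_le_log (by exact_mod_cast hpos) h1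
                  _ = _ := by rw [Real.log_pow]; push_cast; rfl
            calc 16 * (N : ℝ) * ∑ v ∈ Icc 1 V, (v : ℝ)⁻¹
                ≤ 16 * (2 * √X) * (1 + (g + 1) * Real.log X) := by
                  gcongr
                  exact (sum_inv_Icc_le V).trans (by linarith)
              _ = 32 * (1 + (g + 1) * Real.log X) * √X := by ring
              _ ≤ _ := by gcongr
          · exact hVW.trans (le_mul_of_one_le_left hW0 hXδ)
      _ = _ := by
          rw [two_mul, Real.rpow_add hX0]
          ring
  · intro d hd d' hd'
    have h1 := (hD d hd).1
    have h2 := (hD d' hd').2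
    have : (d' : ℝ) ≤ ((d + N ^ 2 : ℕ) : ℝ) := by
      push_cast
      linarith
    exact_mod_cast this
  · intro d hd
    obtain ⟨u, v, hv, hvk, heq⟩ := hrep d hd
    refine ⟨u, v, hv, Nat.le_floor ?_, hvk, heq⟩
    have h1 : (d : ℝ) * v ^ 2 ≤ 4 * (k : ℝ) ^ g := by
      have : d * v ^ 2 ≤ 4 * k ^ g := by rw [heq]; exact Nat.le_add_left _ _
      exact_mod_cast this
    rw [hW, le_div_iff₀ hsq]
    refine le_of_sq_le_sq ?_ (by positivity)
    calc ((v : ℝ) * √X) ^ 2 = X * v ^ 2 := by rw [mul_pow, hsqX]; ring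
      _ ≤ (d : ℝ) * (v : ℝ) ^ 2 := by gcongr; exact (hD d hd).1
      _ ≤ 4 * (k : ℝ) ^ g := h1
      _ ≤ 4 * (Y ^ 2) ^ g := by gcongr
      _ = _ := by ring

end

section

open Finset NumberTheorySymbols Filter

theorem half_card_le_abs_sum_jacobiSym {y d : ℕ} (hd : d ≠ 0)
    (h1 : 8 * ((oddPrimesLE y).filter fun p => J(-(d : ℤ) | p) = 1).card < (oddPrimesLE y).card)
    (h2 : 8 * d.divisors.card ≤ (oddPrimesLE y).card) :
    (((oddPrimesLE y).card / 2 : ℕ) : ℤ) ≤ |∑ p ∈ oddPrimesLE y, J(-(d : ℤ) | p)| := by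
  have key : ∀ p ∈ oddPrimesLE y, J(-(d : ℤ) | p) + 1 ≤
      2 * (if J(-(d : ℤ) | p) = 1 then 1 else 0) + (if p ∣ d then 1 else 0) := fun p hp => by
    rw [mem_oddPrimesLE] at hp
    rcases jacobiSym.trichotomy (-(d : ℤ)) p with h0 | h0 | h0
    · have hpd : p ∣ d := by
        by_contra hnd
        have : NeZero p := ⟨hp.2.1.ne_zero⟩
        rw [jacobiSym.eq_zero_iff_not_coprime] at h0
        rw [Int.neg_gcd] at h0
        exact h0 ((Nat.coprime_comm.mp ((hp.2.1.coprime_iff_not_dvd).mpr hnd)))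
      simp [h0, hpd]
    · rw [h0, if_pos rfl]
      split_ifs <;> norm_num
    · rw [h0]
      split_ifs <;> norm_num
  have hsum := sum_le_sum key
  rw [sum_add_distrib, sum_add_distrib, ← mul_sum, sum_boole, sum_boole, sum_const,
    nsmul_eq_mul, mul_one] at hsum
  have h3 : ((oddPrimesLE y).filter fun p => p ∣ d).card ≤ d.divisors.card :=
    card_le_card fun p hp => Nat.mem_divisors.mpr ⟨(mem_filter.mp hp).2, hd⟩
  rw [abs_of_nonpos (by omega)]
  omega

set_option maxHeartbeats 1000000 in
theorem exists_eventually_card_exceptional_le {δ κ : ℝ} (hδ : 0 < δ) (hδκ : 2 * δ < κ)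
    (hδ2 : δ ≤ 1 / 2) (K : ℕ) (hK : 1 / 2 ≤ κ * (K + 1)) :
    ∃ C : ℝ, 0 < C ∧ ∀ᶠ X : ℝ in atTop, ∀ Y : ℝ, X ^ κ ≤ Y → Y ≤ X → ∀ B : Finset ℕ,
      (∀ d ∈ B, X ≤ d ∧ (d : ℝ) < 2 * X ∧
        8 * ((oddPrimesLE ⌊Y⌋₊).filter fun p => J(-(d : ℤ) | p) = 1).card <
          (oddPrimesLE ⌊Y⌋₊).card) →
      (B.card : ℝ) ≤ C * (X ^ (1 / 2 + δ + 2 * δ * K) * Y + 1) := by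
  have hκ : 0 < κ := by linarith
  obtain ⟨C, hC, hdiv⟩ := exists_card_divisors_le_rpow (δ := (κ - 2 * δ) / 2) (by linarith)
  obtain ⟨A, hA⟩ := exists_nat_ge (1 / (2 * δ))
  have hA' : 1 ≤ 2 * δ * (A + 1) := by
    rw [div_le_iff₀ (by positivity)] at hA
    nlinarith
  set D : ℝ := ((K : ℝ) + 1) ^ (2 * K) * 3 ^ (A + 1) with hD
  have hD1 : 1 ≤ D := one_le_mul_of_one_le_of_one_le
    (one_le_pow₀ (by linarith [Nat.cast_nonneg (α := ℝ) K])) (one_le_pow₀ (by norm_num))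
  refine ⟨(2 * (A + 1)) ^ A * 16 ^ K * D, by positivity, ?_⟩
  filter_upwards [eventually_le_card_oddPrimesLE hδ hκ,
    (tendsto_rpow_atTop (show 0 < (κ - 2 * δ) / 2 by linarith)).eventually_ge_atTop
      (8 * C * 2 ^ ((κ - 2 * δ) / 2)),
    eventually_ge_atTop (2 * ((A : ℝ) + 1))] with X hXn hXC hXA Y hY1 hY2 B hB
  have hA0 : (0 : ℝ) ≤ A := by positivity
  have hX2 : 2 ≤ X := by linarith
  have hX0 : 0 < X := by linarith
  have hX1 : 1 ≤ X := by linarith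
  have hY1' : 1 ≤ Y := le_trans (Real.one_le_rpow hX1 hκ.le) hY1
  have hY0 : 0 < Y := by linarith
  set n := (oddPrimesLE ⌊Y⌋₊).card with hn
  have hnY := hXn Y hY1 hY2
  have hBne : ∀ d ∈ B, d ≠ 0 := by
    rintro d hd rfl
    have := (hB 0 hd).1
    rw [Nat.cast_zero] at this
    linarith
  have hdn : ∀ d ∈ B, 8 * d.divisors.card ≤ n := fun d hd => by
    obtain ⟨h1, h2, -⟩ := hB d hd
    have hd0 := hBne d hd
    have h3 : (8 * d.divisors.card : ℝ) ≤ n := by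
      calc (8 * d.divisors.card : ℝ) ≤ 8 * (C * (d : ℝ) ^ ((κ - 2 * δ) / 2)) := by
            gcongr; exact hdiv d hd0
        _ ≤ 8 * (C * (2 * X) ^ ((κ - 2 * δ) / 2)) := by gcongr
        _ = 8 * C * 2 ^ ((κ - 2 * δ) / 2) * X ^ ((κ - 2 * δ) / 2) := by
          rw [Real.mul_rpow (by norm_num) hX0.le]; ring
        _ ≤ X ^ ((κ - 2 * δ) / 2) * X ^ ((κ - 2 * δ) / 2) := by gcongr
        _ = X ^ κ * X ^ (-(2 * δ)) := by
          rw [← Real.rpow_add hX0, ← Real.rpow_add hX0]; ring_nf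
        _ ≤ Y * X ^ (-(2 * δ)) := by gcongr
        _ ≤ n := hnY
    exact_mod_cast h3
  rcases B.eq_empty_or_nonempty with rfl | ⟨d₀, hd₀⟩
  · simp only [card_empty, Nat.cast_zero]
    positivity
  have hn8 : 8 ≤ n := by
    have h1 := hdn d₀ hd₀
    have h2 : 0 < d₀.divisors.card := by
      rw [card_pos, Nat.nonempty_divisors]
      exact hBne d₀ hd₀
    omega
  have hex : ∃ j : ℕ, X ^ (1 / 2 - δ) ≤ Y ^ (j + 1) := ⟨K, by
    calc X ^ (1 / 2 - δ) ≤ X ^ (κ * (K + 1)) :=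
          Real.rpow_le_rpow_of_exponent_le hX1 (by linarith)
      _ = (X ^ κ) ^ (K + 1) := by
          rw [Real.rpow_mul hX0.le, ← Real.rpow_natCast]; push_cast; rfl
      _ ≤ Y ^ (K + 1) := by gcongr⟩
  classical
  obtain ⟨k, hkK, hk1, hk2⟩ : ∃ k ≤ K, X ^ (1 / 2 - δ) ≤ Y ^ (k + 1) ∧ Y ^ k ≤ X ^ (1 / 2 - δ) := by
    refine ⟨Nat.find hex, Nat.find_min' hex ?_, Nat.find_spec hex, ?_⟩
    · calc X ^ (1 / 2 - δ) ≤ X ^ (κ * (K + 1)) :=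
            Real.rpow_le_rpow_of_exponent_le hX1 (by linarith)
        _ = (X ^ κ) ^ (K + 1) := by
            rw [Real.rpow_mul hX0.le, ← Real.rpow_natCast]; push_cast; rfl
        _ ≤ Y ^ (K + 1) := by gcongr
    · rcases hj : Nat.find hex with _ | j
      · rw [pow_zero]
        exact Real.one_le_rpow hX1 (by linarith)
      · have := Nat.find_min hex (m := j) (by omega)
        exact (not_le.mp this).le
  set M := ⌊X / (A + 1)⌋₊ with hM
  set L := ⌈2 * X⌉₊ with hL
  have hMX : (M : ℝ) ≤ X / (A + 1) := Nat.floor_le (by positivity)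
  have hMX2 : X / (2 * (A + 1)) ≤ M := by
    have h1 : 1 ≤ X / (2 * (A + 1)) := (one_le_div (by positivity)).mpr hXA
    have h2 := Nat.lt_floor_add_one (X / (A + 1))
    have h3 : X / (A + 1) = 2 * (X / (2 * (A + 1))) := by field_simp
    rw [← hM] at h2
    linarith
  have hLX : (L : ℝ) ≤ 3 * X := by
    have := Nat.ceil_lt_add_one (show 0 ≤ 2 * X by linarith)
    linarith
  have hAMX : (A * M : ℝ) ≤ X := by
    calc (A * M : ℝ) ≤ (A + 1) * (X / (A + 1)) := by gcongr; linarith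
      _ = X := by field_simp
  have hML : M ≤ L := by
    have h1 : (M : ℝ) ≤ L := by
      calc (M : ℝ) ≤ X / (A + 1) := hMX
        _ ≤ X := div_le_self hX0.le (by linarith)
        _ ≤ 2 * X := by linarith
        _ ≤ L := Nat.le_ceil _
    exact_mod_cast h1
  have main := card_mul_pow_le_of_abs_sum_jacobiSym_ge (y := ⌊Y⌋₊) (k := k) (A := A) (t := n / 2)
    hML (B := B) (fun d hd => by
      obtain ⟨h1, h2, -⟩ := hB d hd
      rw [mem_Ico]
      exact ⟨by exact_mod_cast hAMX.trans h1, Nat.lt_ceil.mpr h2⟩)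
    (fun d hd => by
      obtain ⟨h1, h2, h3⟩ := hB d hd
      exact half_card_le_abs_sum_jacobiSym (hBne d hd) h3 (hdn d hd))
  rw [← hn] at main
  have main' : (M : ℝ) ^ A * (B.card * ((n / 2 : ℕ) : ℝ) ^ (2 * k)) ≤
      (k : ℝ) ^ (2 * k) * (n : ℝ) ^ k * (L : ℝ) ^ (A + 1) +
        (n : ℝ) ^ (2 * k) * ((⌊Y⌋₊ : ℝ) ^ (2 * k)) ^ (A + 1) := by exact_mod_cast main
  have hn0 : (0 : ℝ) < n := by exact_mod_cast (by omega : 0 < n)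
  have ht : (n : ℝ) / 4 ≤ ((n / 2 : ℕ) : ℝ) := by
    have h1 : n ≤ 4 * (n / 2) := by omega
    have h2 : (n : ℝ) ≤ 4 * ((n / 2 : ℕ) : ℝ) := by exact_mod_cast h1
    linarith
  set E : ℝ := X ^ (1 / 2 + δ + 2 * δ * K) * Y with hE
  have hE0 : 0 ≤ E := by positivity
  have hXE : X ≤ E * (n : ℝ) ^ k := by
    have h1 : X ^ (1 / 2 - δ) * X ^ (-(2 * δ) * K) ≤ Y * (n : ℝ) ^ k := by
      calc X ^ (1 / 2 - δ) * X ^ (-(2 * δ) * K) ≤ Y ^ (k + 1) * X ^ (-(2 * δ) * k) := by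
            gcongr ?_ * ?_
            refine Real.rpow_le_rpow_of_exponent_le hX1 ?_
            have : (k : ℝ) ≤ K := by exact_mod_cast hkK
            nlinarith
        _ = Y * (Y * X ^ (-(2 * δ))) ^ k := by
            rw [Real.rpow_mul hX0.le, Real.rpow_natCast]; ring
        _ ≤ Y * (n : ℝ) ^ k := by gcongr
    calc X = X ^ (1 / 2 + δ + 2 * δ * K) * (X ^ (1 / 2 - δ) * X ^ (-(2 * δ) * K)) := by
          rw [← Real.rpow_add hX0, ← Real.rpow_add hX0]
          ring_nf
          rw [Real.rpow_one]
      _ ≤ X ^ (1 / 2 + δ + 2 * δ * K) * (Y * (n : ℝ) ^ k) := by gcongr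
      _ = _ := by rw [hE]; ring
  have hYX : ((⌊Y⌋₊ : ℝ) ^ (2 * k)) ^ (A + 1) ≤ X ^ A := by
    calc ((⌊Y⌋₊ : ℝ) ^ (2 * k)) ^ (A + 1) ≤ (Y ^ (2 * k)) ^ (A + 1) := by
          gcongr; exact Nat.floor_le hY0.le
      _ = ((Y ^ k) ^ 2) ^ (A + 1) := by rw [← pow_mul Y k 2, mul_comm k 2]
      _ ≤ ((X ^ (1 / 2 - δ)) ^ 2) ^ (A + 1) := by gcongr
      _ = X ^ ((1 - 2 * δ) * (A + 1)) := by
          rw [← pow_mul, ← Real.rpow_natCast, ← Real.rpow_mul hX0.le]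
          congr 1
          push_cast
          ring
      _ ≤ X ^ (A : ℝ) := Real.rpow_le_rpow_of_exponent_le hX1 (by linarith)
      _ = X ^ A := Real.rpow_natCast _ _
  have hkk : (k : ℝ) ^ (2 * k) ≤ ((K : ℝ) + 1) ^ (2 * K) := by
    calc (k : ℝ) ^ (2 * k) ≤ ((K : ℝ) + 1) ^ (2 * k) := by
          gcongr
          have : (k : ℝ) ≤ K := by exact_mod_cast hkK
          linarith
      _ ≤ _ := pow_le_pow_right₀ (by linarith [Nat.cast_nonneg (α := ℝ) K]) (by omega)
  have hupper : (k : ℝ) ^ (2 * k) * (n : ℝ) ^ k * (L : ℝ) ^ (A + 1) +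
        (n : ℝ) ^ (2 * k) * ((⌊Y⌋₊ : ℝ) ^ (2 * k)) ^ (A + 1) ≤
      X ^ A * (n : ℝ) ^ (2 * k) * (D * (E + 1)) := by
    calc _ ≤ ((K : ℝ) + 1) ^ (2 * K) * (n : ℝ) ^ k * (3 * X) ^ (A + 1) +
          (n : ℝ) ^ (2 * k) * X ^ A := by gcongr
      _ = D * (n : ℝ) ^ k * X ^ A * X + (n : ℝ) ^ (2 * k) * X ^ A := by rw [hD]; ring
      _ ≤ D * (n : ℝ) ^ k * X ^ A * (E * (n : ℝ) ^ k) + D * ((n : ℝ) ^ (2 * k) * X ^ A) := by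
          refine add_le_add (by gcongr) (le_mul_of_one_le_left (by positivity) hD1)
      _ = _ := by ring
  have hlower : X ^ A * (n : ℝ) ^ (2 * k) * B.card ≤ (2 * (A + 1)) ^ A * 16 ^ K *
      ((M : ℝ) ^ A * (B.card * ((n / 2 : ℕ) : ℝ) ^ (2 * k))) := by
    calc X ^ A * (n : ℝ) ^ (2 * k) * B.card
        = (2 * (A + 1)) ^ A * 16 ^ k *
          ((X / (2 * (A + 1))) ^ A * (B.card * ((n : ℝ) / 4) ^ (2 * k))) := by
          rw [div_pow, div_pow, show (4 : ℝ) ^ (2 * k) = 16 ^ k by rw [pow_mul]; norm_num]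
          field_simp
      _ ≤ _ := by
          gcongr
          norm_num
  have hpos : 0 < X ^ A * (n : ℝ) ^ (2 * k) := by positivity
  refine le_of_mul_le_mul_left ?_ hpos
  calc X ^ A * (n : ℝ) ^ (2 * k) * B.card ≤ _ := hlower
    _ ≤ (2 * (A + 1)) ^ A * 16 ^ K * (X ^ A * (n : ℝ) ^ (2 * k) * (D * (E + 1))) :=
        mul_le_mul_of_nonneg_left (main'.trans hupper) (by positivity)
    _ = _ := by ring

end

section

open Finset NumberTheorySymbols Filter

/-- Double counting for a relation between two finite sets. -/
theorem card_mul_le_card_mul_of_rel {ι κ : Type*} (Q : ι → κ → Prop) [∀ d, DecidablePred (Q d)]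
    {B : Finset ι} {T : Finset κ} {r M : ℝ}
    (h : ∀ d ∈ B, r ≤ ((T.filter (Q d)).card : ℝ))
    (hM : ∀ x ∈ T, ∀ D ⊆ B, (∀ d ∈ D, Q d x) → (D.card : ℝ) ≤ M) :
    B.card * r ≤ T.card * M := by
  classical
  have h1 := sum_card_bipartiteAbove_eq_sum_card_bipartiteBelow Q (s := B) (t := T)
  calc B.card * r = ∑ _d ∈ B, r := by rw [sum_const, nsmul_eq_mul]
    _ ≤ ∑ d ∈ B, ((T.bipartiteAbove Q d).card : ℝ) := sum_le_sum fun d hd => by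
        refine (h d hd).trans_eq ?_
        congr! 2
    _ = ∑ x ∈ T, ((B.bipartiteBelow Q x).card : ℝ) := by exact_mod_cast h1
    _ ≤ ∑ _x ∈ T, M := sum_le_sum fun x hx =>
        hM x hx _ (filter_subset _ _) fun d hd => (mem_filter.mp hd).2
    _ = T.card * M := by rw [sum_const, nsmul_eq_mul]

theorem le_mul_sq_of_sq_mul_le {a s D Y H q R : ℝ} (ha0 : 0 < a) (hs0 : 0 < s) (hD0 : 0 < D)
    (hH : 0 < H) (h5 : q ^ 2 * H ≤ D * (s * a) * (R + q)) (hYH : Y * H = s * a ^ 4)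
    (h7 : Y ≤ 8 * q * a ^ 2) (hXC : 256 * D ≤ a) : Y ≤ R * a ^ 2 := by
  have h8 : s * a ^ 2 ≤ 8 * (q * H) := by
    have : s * a ^ 4 ≤ 8 * q * a ^ 2 * H := by
      rw [← hYH]; gcongr
    refine le_of_mul_le_mul_right (a := a ^ 2) ?_ (by positivity)
    linarith
  have hQ0 : 0 < q := by
    by_contra h
    have := mul_pos hs0 (pow_pos ha0 2)
    have : q * H ≤ 0 := mul_nonpos_of_nonpos_of_nonneg (not_lt.mp h) hH.le
    linarith
  have h9 : 2 * (D * (s * a)) ≤ q * H := by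
    have : 256 * D * (s * a) ≤ a * (s * a) := by gcongr
    have := mul_pos hD0 (mul_pos hs0 ha0)
    linarith
  have h10 : q ^ 2 * H ≤ 2 * (D * (s * a)) * R := by
    have := mul_le_mul_of_nonneg_left h9 hQ0.le
    linarith
  have h11 : q * (s * a ^ 2) ≤ 16 * (D * (s * a)) * R := by
    have := mul_le_mul_of_nonneg_left h8 hQ0.le
    linarith
  have h12 : q * a ≤ 16 * D * R := by
    refine le_of_mul_le_mul_right (a := s * a) ?_ (by positivity)
    linarith
  have h13 : q * 16 ≤ R := by
    refine le_of_mul_le_mul_right (a := 16 * D) ?_ (by positivity)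
    calc q * 16 * (16 * D) = q * (256 * D) := by ring
      _ ≤ q * a := by gcongr
      _ ≤ _ := by linarith
  have h14 := mul_le_mul_of_nonneg_right h13 (pow_pos ha0 2).le
  have h15 := mul_pos hQ0 (pow_pos ha0 2)
  linarith

open Classical in
/-- If `ℚ(√-d)` has many `g`-torsion classes and many split primes up to `Y`, then
`4 (p q) ^ g = u ^ 2 + d v ^ 2` is solvable for many pairs `(p, q)` of primes up to `Y`. -/
theorem eventually_le_card_collisions {g : ℕ} (hg : g ≠ 0) {δ : ℝ} (hδ : 0 < δ) :
    ∀ᶠ X : ℝ in atTop, ∀ Y H : ℝ, 0 < Y → 1 ≤ H → Y * H = X ^ (1 / 2 + 4 * δ) →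
      ∀ P : Finset ℕ, (∀ p ∈ P, p.Prime ∧ p ≠ 2) →
      Y * X ^ (-(2 * δ)) ≤ P.card →
      ∀ d : ℕ, Squarefree d → X ≤ d → (d : ℝ) < 2 * X → H < hneg g d →
        P.card ≤ 8 * (P.filter fun p => J(-(d : ℤ) | p) = 1).card →
        Y * X ^ (-(2 * δ)) ≤ ((P.offDiag.filter fun x => ∃ u v : ℕ,
          v.Coprime (x.1 * x.2) ∧ 4 * (x.1 * x.2) ^ g = u ^ 2 + d * v ^ 2).card : ℝ) := by
  obtain ⟨C, hC1, hC⟩ := exists_card_classGroup_le hδ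
  filter_upwards [eventually_ge_atTop 1,
    (tendsto_rpow_atTop hδ).eventually_ge_atTop (256 * (2 ^ (1 / 2 + δ) * C))] with
    X hX1 hXC Y H hY hH hYH P hP hPY d hd hXd hdX hHd hPd
  have hX0 : 0 < X := by linarith
  set Q := P.filter fun p => J(-(d : ℤ) | p) = 1 with hQ
  have h1 := card_sq_mul_hneg_le (g := g) hd hg Q fun p hp => by
    rw [hQ, mem_filter] at hp
    exact ⟨(hP p hp.1).1, (hP p hp.1).2, hp.2⟩
  set R := (P.offDiag.filter fun x => ∃ u v : ℕ,
          v.Coprime (x.1 * x.2) ∧ 4 * (x.1 * x.2) ^ g = u ^ 2 + d * v ^ 2).card with hR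
  have h2 : Q.card ^ 2 * hneg g d ≤
      Nat.card (ClassGroup (NumberField.RingOfIntegers (Kneg d))) * (R + Q.card) := by
    refine h1.trans ?_
    gcongr
    rw [hR]
    exact card_le_card (filter_subset_filter _ (offDiag_mono (filter_subset _ _)))
  have h3 := hC d hd.ne_zero (Kneg d) (Kneg.intGen d) (Kneg.finrank_eq hd.ne_zero)
    (Kneg.isImagQuadOrder hd)
  set D : ℝ := 2 ^ (1 / 2 + δ) * C with hD
  have hD0 : 0 < D := by positivity
  have h4 : (Nat.card (ClassGroup (NumberField.RingOfIntegers (Kneg d))) : ℝ) ≤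
      D * X ^ (1 / 2 + δ) := by
    refine h3.trans ?_
    calc C * (d : ℝ) ^ (1 / 2 + δ) ≤ C * (2 * X) ^ (1 / 2 + δ) := by gcongr
      _ = D * X ^ (1 / 2 + δ) := by rw [Real.mul_rpow (by norm_num) hX0.le, hD]; ring
  have h5 : (Q.card : ℝ) ^ 2 * H ≤ D * X ^ (1 / 2 + δ) * (R + Q.card) := by
    calc (Q.card : ℝ) ^ 2 * H ≤ (Q.card : ℝ) ^ 2 * (hneg g d : ℝ) := by gcongr
      _ ≤ (Nat.card (ClassGroup (NumberField.RingOfIntegers (Kneg d))) : ℝ) *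
          (R + Q.card) := by
        exact_mod_cast h2
      _ ≤ _ := by gcongr
  have h6 : Y * X ^ (-(2 * δ)) ≤ 8 * Q.card := hPY.trans (by exact_mod_cast hPd)
  set a := X ^ δ with ha
  set s := X ^ (1 / 2 : ℝ) with hs
  have ha0 : 0 < a := by positivity
  have hs0 : 0 < s := by positivity
  have e1 : X ^ (1 / 2 + δ) = s * a := Real.rpow_add hX0 _ _
  have e2 : X ^ (-(2 * δ)) = (a ^ 2)⁻¹ := by
    rw [Real.rpow_neg hX0.le, mul_comm, Real.rpow_mul hX0.le]; norm_num [ha]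
  have e3 : X ^ (1 / 2 + 4 * δ) = s * a ^ 4 := by
    rw [Real.rpow_add hX0, mul_comm 4 δ, Real.rpow_mul hX0.le]; norm_num [ha, hs]
  rw [e1] at h5
  rw [e2] at h6 ⊢
  rw [e3] at hYH
  have h7 : Y ≤ 8 * Q.card * a ^ 2 := by
    rwa [← div_eq_mul_inv, div_le_iff₀ (by positivity)] at h6
  rw [← div_eq_mul_inv, div_le_iff₀ (by positivity)]
  exact le_mul_sq_of_sq_mul_le ha0 hs0 hD0 (by linarith) h5 hYH h7 hXC

end

section

open Finset NumberTheorySymbols Filter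

/-- The bound for discriminants with many split primes. -/
theorem eventually_card_many_split_le {g : ℕ} (hg : g ≠ 0) {δ κ : ℝ} (hδ : 0 < δ) (hκ : 0 < κ) :
    ∀ᶠ X : ℝ in atTop, ∀ Y H : ℝ, X ^ κ ≤ Y → Y ≤ X → 1 ≤ H → Y * H = X ^ (1 / 2 + 4 * δ) →
      ∀ B : Finset ℕ, (∀ d ∈ B, Squarefree d ∧ X ≤ d ∧ (d : ℝ) < 2 * X ∧ H < hneg g d ∧
        (oddPrimesLE ⌊Y⌋₊).card ≤
          8 * ((oddPrimesLE ⌊Y⌋₊).filter fun p => J(-(d : ℤ) | p) = 1).card) →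
      (B.card : ℝ) ≤ Y * X ^ (4 * δ) * (√X + 2 * Y ^ g / √X) := by
  classical
  filter_upwards [eventually_ge_atTop 1, eventually_le_card_collisions hg hδ,
    eventually_le_card_oddPrimesLE hδ hκ, eventually_card_le_of_four_mul_pow_eq g hδ]
    with X hX1 hcol hprimes hrep Y H hY1 hY2 hH hYH B hB
  have hX0 : 0 < X := by linarith
  have hY0 : 0 < Y := lt_of_lt_of_le (by positivity) hY1
  set P := oddPrimesLE ⌊Y⌋₊ with hP
  have hPY : (P.card : ℝ) ≤ Y :=
    (Nat.cast_le.mpr (card_oddPrimesLE_le _)).trans (Nat.floor_le hY0.le)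
  have hle : ∀ p ∈ P, (p : ℝ) ≤ Y ∧ 1 < p := fun p hp => by
    rw [hP, mem_oddPrimesLE] at hp
    exact ⟨(Nat.cast_le.mpr hp.1).trans (Nat.floor_le hY0.le), hp.2.1.one_lt⟩
  have key := card_mul_le_card_mul_of_rel
    (fun (d : ℕ) (x : ℕ × ℕ) => ∃ u v : ℕ,
      v.Coprime (x.1 * x.2) ∧ 4 * (x.1 * x.2) ^ g = u ^ 2 + d * v ^ 2)
    (B := B) (T := P.offDiag) (r := Y * X ^ (-(2 * δ)))
    (M := X ^ (2 * δ) * (√X + 2 * Y ^ g / √X))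
    (fun d hd => by
      obtain ⟨h1, h2, h3, h4, h5⟩ := hB d hd
      exact hcol Y H hY0 hH hYH P (fun p hp => (mem_oddPrimesLE.mp hp).2)
        (hprimes Y hY1 hY2) d h1 h2 h3 h4 h5)
    (fun x hx D hD hDx => by
      rw [mem_offDiag] at hx
      refine hrep Y hY0.le hY2 D (fun d hd => ⟨(hB d (hD hd)).2.1, (hB d (hD hd)).2.2.1⟩)
        (x.1 * x.2) ?_ fun d hd => ?_
      · rw [Nat.cast_mul, sq]
        exact mul_le_mul (hle _ hx.1).1 (hle _ hx.2.1).1 (Nat.cast_nonneg _) hY0.le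
      · obtain ⟨u, v, hv, huv⟩ := hDx d hd
        refine ⟨u, v, Nat.pos_of_ne_zero fun h0 => ?_, hv, huv⟩
        rw [h0, Nat.coprime_zero_left] at hv
        exact absurd (Nat.eq_one_of_mul_eq_one_right hv) (hle _ hx.1).2.ne')
  have hT : (P.offDiag.card : ℝ) ≤ Y * Y := by
    calc (P.offDiag.card : ℝ) ≤ (P.card * P.card : ℕ) := by
          rw [offDiag_card]; exact_mod_cast Nat.sub_le _ _
      _ ≤ Y * Y := by push_cast; gcongr
  refine le_of_mul_le_mul_right (a := Y * X ^ (-(2 * δ))) ?_ (by positivity)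
  calc B.card * (Y * X ^ (-(2 * δ))) ≤ _ := key
    _ ≤ Y * Y * (X ^ (2 * δ) * (√X + 2 * Y ^ g / √X)) := by gcongr
    _ = Y * (X ^ (4 * δ) * X ^ (-(2 * δ))) * Y * (√X + 2 * Y ^ g / √X) := by
        rw [← Real.rpow_add hX0, show 4 * δ + -(2 * δ) = 2 * δ by ring]; ring
    _ = _ := by ring

theorem exists_eventually_card_le {g : ℕ} (hg : g ≠ 0) {ε : ℝ} (hε : 0 < ε)
    (hεg : ε ≤ 1 / (8 * g)) :
    ∃ C : ℝ, 0 < C ∧ ∀ᶠ X : ℝ in atTop, ∀ H : ℝ, 1 ≤ H →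
      H ≤ X ^ ((1 : ℝ) / 2 - 1 / (2 * g) + ε) →
      ∀ S : Finset ℕ, (∀ d ∈ S, Squarefree d ∧ X ≤ d ∧ (d : ℝ) < 2 * X ∧ H < hneg g d) →
      (S.card : ℝ) ≤
        C * X ^ ε * (X * H ^ (-(1 : ℝ)) + X ^ ((g : ℝ) / 2) * H ^ (-((g : ℝ) + 1))) := by
  classical
  obtain ⟨δ, hδε⟩ : ∃ δ, ε = 8 * ((g : ℝ) + 1) * δ := ⟨ε / (8 * ((g : ℝ) + 1)), by field_simp⟩
  have hg1 : (1 : ℝ) ≤ g := by exact_mod_cast Nat.one_le_iff_ne_zero.mpr hg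
  have hδ : 0 < δ := by
    by_contra h
    have : 8 * ((g : ℝ) + 1) * δ ≤ 0 :=
      mul_nonpos_of_nonneg_of_nonpos (by positivity) (not_lt.mp h)
    linarith
  set κ : ℝ := 1 / (4 * g) with hκdef
  have hκ : 0 < κ := by positivity
  have hεκ : ε ≤ κ / 2 := hεg.trans_eq (by rw [hκdef]; field_simp; norm_num)
  have hδg : δ ≤ g * δ := le_mul_of_one_le_left hδ.le hg1
  have hκ1 : κ ≤ 1 / 4 := by
    rw [hκdef]; gcongr; linarith
  have hδκ : 16 * δ ≤ κ / 2 := by linarith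
  have hgκ : κ * g = 1 / 4 := by rw [hκdef]; field_simp
  have h2g : (1 : ℝ) / (2 * g) = 2 * κ := by rw [hκdef]; field_simp; norm_num
  obtain ⟨C, hC0, hC⟩ := exists_eventually_card_exceptional_le hδ (κ := κ) (by linarith)
    (by linarith) (2 * g) (by push_cast; nlinarith)
  refine ⟨2 * C + 2, by positivity, ?_⟩
  filter_upwards [eventually_ge_atTop 1, hC, eventually_card_many_split_le hg hδ hκ]
    with X hX1 hexc hmany H hH1 hHX S hS
  have hX0 : 0 < X := by linarith
  have hH0 : 0 < H := by linarith
  set Y := X ^ (1 / 2 + 4 * δ) / H with hY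
  have hY0 : 0 < Y := by positivity
  have hYH : Y * H = X ^ (1 / 2 + 4 * δ) := div_mul_cancel₀ _ hH0.ne'
  have hY1 : X ^ κ ≤ Y := by
    rw [hY, le_div_iff₀ hH0]
    calc X ^ κ * H ≤ X ^ κ * X ^ ((1 : ℝ) / 2 - 1 / (2 * g) + ε) := by gcongr
      _ = X ^ (κ + (1 / 2 - 1 / (2 * g) + ε)) := (Real.rpow_add hX0 _ _).symm
      _ ≤ _ := Real.rpow_le_rpow_of_exponent_le hX1 (by rw [h2g]; linarith)
  have hY2 : Y ≤ X := by
    calc Y ≤ X ^ (1 / 2 + 4 * δ) := div_le_self (by positivity) hH1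
      _ ≤ X ^ (1 : ℝ) := Real.rpow_le_rpow_of_exponent_le hX1 (by linarith)
      _ = X := Real.rpow_one X
  have hsplit := card_filter_add_card_filter_not (s := S) (fun d : ℕ =>
    8 * ((oddPrimesLE ⌊Y⌋₊).filter fun p => J(-(d : ℤ) | p) = 1).card < (oddPrimesLE ⌊Y⌋₊).card)
  have b1 := hexc Y hY1 hY2 (S.filter fun d : ℕ =>
    8 * ((oddPrimesLE ⌊Y⌋₊).filter fun p => J(-(d : ℤ) | p) = 1).card < (oddPrimesLE ⌊Y⌋₊).card)
    fun d hd => by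
      rw [mem_filter] at hd
      exact ⟨(hS d hd.1).2.1, (hS d hd.1).2.2.1, hd.2⟩
  have b2 := hmany Y H hY1 hY2 hH1 hYH (S.filter fun d : ℕ =>
    ¬ 8 * ((oddPrimesLE ⌊Y⌋₊).filter fun p => J(-(d : ℤ) | p) = 1).card <
      (oddPrimesLE ⌊Y⌋₊).card)
    fun d hd => by
      rw [mem_filter, not_lt] at hd
      obtain ⟨h1, h2, h3, h4⟩ := hS d hd.1
      exact ⟨h1, h2, h3, h4, hd.2⟩
  rw [← hsplit, Nat.cast_add]
  have hHm : H ^ (-(1 : ℝ)) = H⁻¹ := Real.rpow_neg_one H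
  set U := X ^ ε * (X * H ^ (-(1 : ℝ))) with hU
  set V := X ^ ε * (X ^ ((g : ℝ) / 2) * H ^ (-((g : ℝ) + 1))) with hV
  have hU' : ∀ e, e ≤ 1 + ε → X ^ e * H⁻¹ ≤ U := fun e he => by
    rw [hU, hHm, ← mul_assoc]
    gcongr
    rw [← Real.rpow_add_one hX0.ne']
    exact Real.rpow_le_rpow_of_exponent_le hX1 (by linarith)
  have hU1 : 1 ≤ U := by
    refine le_trans ?_ (hU' (1 + ε) le_rfl)
    rw [← div_eq_mul_inv, one_le_div hH0]
    exact hHX.trans (Real.rpow_le_rpow_of_exponent_le hX1 (by rw [h2g]; linarith))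
  have hYi : Y = X ^ (1 / 2 + 4 * δ) * H⁻¹ := div_eq_mul_inv _ _
  have c1 : X ^ (1 / 2 + δ + 2 * δ * (2 * g : ℕ)) * Y ≤ U := by
    rw [hYi, ← mul_assoc, ← Real.rpow_add hX0]
    refine hU' _ ?_
    push_cast
    linarith
  have c2 : Y * X ^ (4 * δ) * √X ≤ U := by
    calc Y * X ^ (4 * δ) * √X = X ^ (1 / 2 + 4 * δ) * X ^ (4 * δ) * X ^ (1 / 2 : ℝ) * H⁻¹ := by
          rw [hYi, Real.sqrt_eq_rpow]; ring
      _ = X ^ (1 / 2 + 4 * δ + 4 * δ + 1 / 2) * H⁻¹ := by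
          rw [← Real.rpow_add hX0, ← Real.rpow_add hX0]
      _ ≤ U := hU' _ (by linarith)
  have c3 : Y * X ^ (4 * δ) * (2 * Y ^ g / √X) ≤ 2 * V := by
    have e1 : Y ^ (g + 1) = X ^ ((1 / 2 + 4 * δ) * (g + 1)) * H ^ (-((g : ℝ) + 1)) := by
      rw [hY, div_pow, Real.rpow_neg hH0.le, ← div_eq_mul_inv, Real.rpow_mul hX0.le]
      norm_cast
    calc Y * X ^ (4 * δ) * (2 * Y ^ g / √X) =
        2 * (Y ^ (g + 1) * X ^ (4 * δ) * (√X)⁻¹) := by ring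
      _ = 2 * (X ^ ((1 / 2 + 4 * δ) * (g + 1)) * X ^ (4 * δ) * X ^ (-(1 / 2 : ℝ)) *
          H ^ (-((g : ℝ) + 1))) := by
        rw [e1, Real.sqrt_eq_rpow, Real.rpow_neg hX0.le]; ring
      _ ≤ 2 * V := by
        rw [hV, ← mul_assoc (X ^ ε), ← Real.rpow_add hX0, ← Real.rpow_add hX0,
          ← Real.rpow_add hX0]
        gcongr 2 * (?_ * _)
        exact Real.rpow_le_rpow_of_exponent_le hX1 (by linarith)
  have hV0 : 0 ≤ V := by positivity
  calc _ ≤ C * (U + U) + (U + 2 * V) := by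
        refine add_le_add (b1.trans ?_) (b2.trans ?_)
        · gcongr
        · rw [mul_add]; linarith
    _ ≤ (2 * C + 2) * (U + V) := by nlinarith [mul_nonneg hC0.le hV0]
    _ = _ := by rw [hU, hV]; ring

end

section

open Finset Filter

theorem exists_card_le_of_le {g : ℕ} (hg : g ≠ 0) {ε : ℝ} (hε : 0 < ε) (hεg : ε ≤ 1 / (8 * g)) :
    ∃ C : ℝ, 0 < C ∧ ∀ X H : ℝ, 2 ≤ X → 1 ≤ H →
      H ≤ X ^ ((1 : ℝ) / 2 - 1 / (2 * g) + ε) →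
      ∀ S : Finset ℕ, (∀ d ∈ S, Squarefree d ∧ X ≤ d ∧ (d : ℝ) < 2 * X ∧ H < hneg g d) →
      (S.card : ℝ) ≤
        C * X ^ ε * (X * H ^ (-(1 : ℝ)) + X ^ ((g : ℝ) / 2) * H ^ (-((g : ℝ) + 1))) := by
  obtain ⟨C, hC0, hC⟩ := exists_eventually_card_le hg hε hεg
  obtain ⟨X₀, hX₀⟩ := eventually_atTop.mp hC
  refine ⟨max C (2 * X₀ + 1), lt_max_of_lt_left hC0, fun X H hX hH hHX S hS => ?_⟩
  have hX0 : 0 < X := by linarith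
  have hX1 : 1 ≤ X := by linarith
  have hH0 : 0 < H := by linarith
  rcases le_total X₀ X with h | h
  · refine (hX₀ X h H hH hHX S hS).trans ?_
    gcongr
    exact le_max_left _ _
  · have h1 : S.card ≤ ⌈2 * X⌉₊ := by
      rw [← card_range ⌈2 * X⌉₊]
      exact card_le_card fun d hd => mem_range.mpr (Nat.lt_ceil.mpr (hS d hd).2.2.1)
    have h2 : (S.card : ℝ) ≤ 2 * X₀ + 1 := by
      have := (Nat.ceil_lt_add_one (by positivity : 0 ≤ 2 * X)).le
      have : (S.card : ℝ) ≤ (⌈2 * X⌉₊ : ℝ) := Nat.cast_le.mpr h1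
      linarith
    have h3 : 1 ≤ X ^ ε * (X * H ^ (-(1 : ℝ))) := by
      rw [Real.rpow_neg_one, ← mul_assoc, ← div_eq_mul_inv, one_le_div hH0,
        ← Real.rpow_add_one hX0.ne']
      refine hHX.trans (Real.rpow_le_rpow_of_exponent_le hX1 ?_)
      have : (0 : ℝ) ≤ 1 / (2 * g) := by positivity
      linarith
    calc (S.card : ℝ) ≤ max C (2 * X₀ + 1) * 1 := by
          rw [mul_one]; exact h2.trans (le_max_right _ _)
      _ ≤ max C (2 * X₀ + 1) * (X ^ ε * (X * H ^ (-(1 : ℝ)) +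
            X ^ ((g : ℝ) / 2) * H ^ (-((g : ℝ) + 1)))) := by
          gcongr
          refine h3.trans ?_
          gcongr
          exact le_add_of_nonneg_right (by positivity)
      _ = _ := by ring

theorem exists_card_le {g : ℕ} (hg : g ≠ 0) {ε : ℝ} (hε : 0 < ε) :
    ∃ C : ℝ, 0 < C ∧ ∀ X H : ℝ, 2 ≤ X → 1 ≤ H →
      H ≤ X ^ ((1 : ℝ) / 2 - 1 / (2 * g) + ε) →
      ∀ S : Finset ℕ, (∀ d ∈ S, Squarefree d ∧ X ≤ d ∧ (d : ℝ) < 2 * X ∧ H < hneg g d) →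
      (S.card : ℝ) ≤
        C * X ^ ε * (X * H ^ (-(1 : ℝ)) + X ^ ((g : ℝ) / 2) * H ^ (-((g : ℝ) + 1))) := by
  have hg1 : (1 : ℝ) ≤ g := by exact_mod_cast Nat.one_le_iff_ne_zero.mpr hg
  set e : ℝ := min ε (1 / (8 * g)) with he
  have he0 : 0 < e := lt_min hε (by positivity)
  have heε : e ≤ ε := min_le_left _ _
  obtain ⟨C, hC0, hC⟩ := exists_card_le_of_le hg he0 (min_le_right _ _)
  refine ⟨2 * C, by positivity, fun X H hX hH hHX S hS => ?_⟩
  have hX0 : 0 < X := by linarith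
  have hX1 : 1 ≤ X := by linarith
  have hH0 : 0 < H := by linarith
  have hg2 : (1 : ℝ) / (2 * g) ≤ 1 / 2 := by gcongr; linarith
  have hg3 : (1 : ℝ) / (2 * g) * g = 1 / 2 := by field_simp
  rcases le_total H (X ^ ((1 : ℝ) / 2 - 1 / (2 * g) + e)) with h | h
  · refine (hC X H hX hH h S hS).trans ?_
    gcongr
    linarith
  set a : ℝ := (1 : ℝ) / 2 - 1 / (2 * g) + e with ha
  have h1 := hC X (X ^ a) hX (Real.one_le_rpow hX1 (by linarith)) le_rfl S
    fun d hd => ⟨(hS d hd).1, (hS d hd).2.1, (hS d hd).2.2.1, h.trans_lt (hS d hd).2.2.2⟩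
  set b : ℝ := 1 / 2 + 1 / (2 * g) with hb
  have h2 : X ^ e * (X * (X ^ a) ^ (-(1 : ℝ))) = X ^ b := by
    rw [← Real.rpow_mul hX0.le, ← mul_assoc, ← Real.rpow_add_one hX0.ne', ← Real.rpow_add hX0]
    congr 1
    rw [ha, hb]; ring
  have h3 : X ^ e * (X ^ ((g : ℝ) / 2) * (X ^ a) ^ (-((g : ℝ) + 1))) ≤ X ^ b := by
    rw [← Real.rpow_mul hX0.le, ← Real.rpow_add hX0, ← Real.rpow_add hX0]
    refine Real.rpow_le_rpow_of_exponent_le hX1 ?_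
    rw [ha, hb]
    nlinarith [mul_pos he0 (by linarith : (0 : ℝ) < g)]
  have h4 : X ^ b ≤ X ^ ε * (X * H ^ (-(1 : ℝ))) := by
    rw [Real.rpow_neg_one, ← mul_assoc, ← div_eq_mul_inv, le_div_iff₀ hH0,
      ← Real.rpow_add_one hX0.ne']
    calc X ^ b * H ≤ X ^ b * X ^ ((1 : ℝ) / 2 - 1 / (2 * g) + ε) := by gcongr
      _ = X ^ (ε + 1) := by
        rw [← Real.rpow_add hX0]; congr 1; rw [hb]; ring
  have h5 : 0 ≤ X ^ ε * (X ^ ((g : ℝ) / 2) * H ^ (-((g : ℝ) + 1))) := by positivity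
  calc (S.card : ℝ) ≤ C * (X ^ e * (X * (X ^ a) ^ (-(1 : ℝ))) +
        X ^ e * (X ^ ((g : ℝ) / 2) * (X ^ a) ^ (-((g : ℝ) + 1)))) := h1.trans_eq (by ring)
    _ ≤ C * (X ^ b + X ^ b) := by rw [h2]; gcongr
    _ ≤ 2 * C * (X ^ ε * (X * H ^ (-(1 : ℝ))) +
        X ^ ε * (X ^ ((g : ℝ) / 2) * H ^ (-((g : ℝ) + 1)))) := by
      rw [mul_comm 2 C, mul_assoc]
      gcongr
      linarith
    _ = _ := by ring

end

/-- Fix a prime `g ≥ 3`.  For every `ε > 0` there is `C = C(g, ε)` such that for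
all `X ≥ 2` and all `1 ≤ H ≤ X^(1/2 - 1/(2g) + ε)`, the number of squarefree
`d ∈ [X, 2X)` with `h_g(-d) > H` is at most
`C·X^ε·(X·H^(-1) + X^(g/2)·H^(-(g+1)))`. -/
theorem Ng_bound (g : ℕ) (hg : g.Prime) (hg3 : 3 ≤ g) (ε : ℝ) (hε : 0 < ε) :
    ∃ C : ℝ, 0 < C ∧ ∀ X H : ℝ, 2 ≤ X → 1 ≤ H →
      H ≤ X ^ ((1 : ℝ) / 2 - 1 / (2 * g) + ε) →
      (((Finset.range (⌈2 * X⌉₊ + 1)).filter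
          (fun d : ℕ => Squarefree d ∧ X ≤ (d : ℝ) ∧ (d : ℝ) < 2 * X ∧
            H < (hneg g d : ℝ))).card : ℝ)
        ≤ C * X ^ ε * (X * H ^ (-(1 : ℝ)) + X ^ ((g : ℝ) / 2) * H ^ (-((g : ℝ) + 1))) := by
  obtain ⟨C, hC0, hC⟩ := exists_card_le hg.ne_zero hε
  exact ⟨C, hC0, fun X H hX hH hHX => hC X H hX hH hHX _ fun d hd => (Finset.mem_filter.mp hd).2⟩
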